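/- arXiv:1008.1266 — 2 statements merged into one kernel-verified Lean document; each statement's English description precedes it below -/
import Mathlib

section
/- Let d = 1. Assume the single-site potential q satisfies (H1) and that E_0(a) ≠ −2 for at least one a ∈ [0, M_1−b_1]. Then the map a ↦ E_0(a) is strictly decreasing on the integer interval [r_1, M_1 − b_1]. -/
open scoped BigOperators

noncomputable section

/-- The set of nearest neighbors of a point of `ℤ`. -/
def nbhd1 (n : ℤ) : Finset ℤ := {n - 1, n + 1}

/-- `n_S(i)`: the number of nearest neighbors of `i` lying outside `S ⊂ ℤ`. -/
def nOut1 (S : Finset ℤ) (i : ℤ) : ℕ :=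
  ((nbhd1 i).filter fun j => j ∉ S).card

/-- The matrix of the one-dimensional Neumann Laplacian `h^N_{0,S}` plus a potential `V`
on the finite set `S ⊂ ℤ`. -/
def neumannMat1 (S : Finset ℤ) (V : ℤ → ℝ) : Matrix S S ℝ :=
  fun i j => (if |(i : ℤ) - (j : ℤ)| = 1 then (-1 : ℝ) else 0)
    + (if i = j then (V (i : ℤ) - (nOut1 S (i : ℤ) : ℝ)) else 0)

/-- `E_0(a) = min σ(h^N_{0,[1,M]} + q_a)` with `q_a = q(· - a)`. -/
def E0₁ (M : ℤ) (q : ℤ → ℝ) (a : ℤ) : ℝ :=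
  sInf (spectrum ℝ (neumannMat1 (Finset.Icc 1 M) (fun n => q (n - a))))

open Matrix

section Hermitian

variable {n : Type*} [Fintype n] [DecidableEq n] {A : Matrix n n ℝ}

/-- Subtracting the bottom of the spectrum from a real symmetric matrix leaves a positive
semidefinite matrix. -/
lemma posSemidef_sub_sInf_spectrum (hA : A.IsHermitian) :
    (A - sInf (spectrum ℝ A) • (1 : Matrix n n ℝ)).PosSemidef := by
  rw [← Algebra.algebraMap_eq_smul_one]
  rw [posSemidef_iff_isHermitian_and_spectrum_nonneg]
  constructor
  · refine hA.sub ?_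
    rw [Matrix.algebraMap_eq_diagonal]
    exact isHermitian_diagonal _
  · intro k hk
    rw [← spectrum.sub_singleton_eq, Set.sub_singleton] at hk
    obtain ⟨x, hx, rfl⟩ := hk
    exact sub_nonneg.2 (csInf_le (Matrix.finite_real_spectrum (A := A)).bddBelow hx)

/-- The bottom of the spectrum of a real symmetric matrix is an eigenvalue. -/
lemma exists_mulVec_eq_sInf_spectrum [Nonempty n] (hA : A.IsHermitian) :
    ∃ u : n → ℝ, u ≠ 0 ∧ A *ᵥ u = sInf (spectrum ℝ A) • u := by
  have hne : (spectrum ℝ A).Nonempty := by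
    rw [hA.spectrum_real_eq_range_eigenvalues]
    exact Set.range_nonempty _
  have hmem := hne.csInf_mem (Matrix.finite_real_spectrum (A := A))
  rw [← Matrix.spectrum_toLin', ← Module.End.hasEigenvalue_iff_mem_spectrum] at hmem
  obtain ⟨u, hu⟩ := hmem.exists_hasEigenvector
  exact ⟨u, hu.2, by simpa using hu.apply_eq_smul⟩

end Hermitian

/-- The Neumann boundary conditions at both ends of `[1, M]`. -/
def IsNeumann (M : ℤ) (f : ℤ → ℝ) : Prop :=
  f 0 = f 1 ∧ f (M + 1) = f M

/-- The discrete Schrödinger operator on `ℤ` with potential `V`. -/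
def schrod (V f : ℤ → ℝ) (n : ℤ) : ℝ :=
  V n * f n - f (n - 1) - f (n + 1)

/-- The bottom of the spectrum of the Neumann operator with potential `V` on `[1, M]`. -/
def groundEnergy (M : ℤ) (V : ℤ → ℝ) : ℝ :=
  sInf (spectrum ℝ (neumannMat1 (Finset.Icc 1 M) V))

lemma neumannMat1_isHermitian (S : Finset ℤ) (V : ℤ → ℝ) : (neumannMat1 S V).IsHermitian := by
  ext i j
  simp only [conjTranspose_apply, neumannMat1, star_trivial, abs_sub_comm (j : ℤ) i]
  congr 1
  by_cases h : i = j
  · subst h; rfl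
  · simp [h, Ne.symm h]

lemma sum_nbhd1 (f : ℤ → ℝ) (n : ℤ) : ∑ j ∈ nbhd1 n, f j = f (n - 1) + f (n + 1) :=
  Finset.sum_pair (by lia)

lemma neumannMat1_mulVec {M : ℤ} (V : ℤ → ℝ) {f : ℤ → ℝ} (hf : IsNeumann M f)
    (i : Finset.Icc 1 M) :
    (neumannMat1 (Finset.Icc 1 M) V *ᵥ fun j => f j) i = schrod V f i := by
  obtain ⟨i, hi⟩ := i
  have hadj : ∑ j : Finset.Icc 1 M, (if |i - (j : ℤ)| = 1 then (-1 : ℝ) else 0) * f j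
      = -∑ j ∈ (nbhd1 i).filter (· ∈ Finset.Icc 1 M), f j := by
    rw [Finset.sum_coe_sort (Finset.Icc 1 M)
      (fun j : ℤ => (if |i - j| = 1 then (-1 : ℝ) else 0) * f j), ← Finset.sum_neg_distrib]
    simp only [ite_mul, neg_mul, one_mul, zero_mul]
    rw [← Finset.sum_filter]
    refine Finset.sum_congr ?_ fun _ _ => rfl
    ext j
    simp only [Finset.mem_filter, nbhd1, Finset.mem_insert, Finset.mem_singleton]
    rw [abs_eq (by norm_num)]
    constructor <;> rintro ⟨h1, h2⟩ <;> refine ⟨by lia, by lia⟩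
  have hout : ∑ j ∈ (nbhd1 i).filter (· ∉ Finset.Icc 1 M), f j
      = (nOut1 (Finset.Icc 1 M) i : ℝ) * f i := by
    rw [nOut1, ← nsmul_eq_mul]
    refine Finset.sum_eq_card_nsmul fun j hj => ?_
    simp only [Finset.mem_filter, nbhd1, Finset.mem_insert, Finset.mem_singleton,
      Finset.mem_Icc] at hj hi
    obtain ⟨rfl, -⟩ | ⟨rfl, -⟩ : (j = 0 ∧ i = 1) ∨ (j = M + 1 ∧ i = M) := by lia
    · rw [hf.1]; congr 1; lia
    · rw [hf.2]; congr 1; lia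
  have hsplit := Finset.sum_filter_add_sum_filter_not (nbhd1 i) (· ∈ Finset.Icc 1 M) f
  rw [sum_nbhd1] at hsplit
  simp only [mulVec, dotProduct, neumannMat1, add_mul, Finset.sum_add_distrib, hadj]
  simp only [ite_mul, zero_mul, Finset.sum_ite_eq, Finset.mem_univ, if_true]
  rw [schrod]
  linarith

/-- The quadratic form of the positive semidefinite matrix `H - E₀`. -/
lemma dotProduct_sub_groundEnergy {M : ℤ} (V : ℤ → ℝ) {f : ℤ → ℝ} (hf : IsNeumann M f) :
    star (fun j : Finset.Icc 1 M => f j) ⬝ᵥ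
      ((neumannMat1 (Finset.Icc 1 M) V -
        groundEnergy M V • (1 : Matrix (Finset.Icc 1 M) (Finset.Icc 1 M) ℝ)) *ᵥ
          fun j : Finset.Icc 1 M => f j)
      = ∑ n ∈ Finset.Icc 1 M, f n * (schrod V f n - groundEnergy M V * f n) := by
  rw [← Finset.sum_coe_sort]
  refine Finset.sum_congr rfl fun i _ => ?_
  simp [sub_mulVec, neumannMat1_mulVec V hf, smul_mulVec]

/-- Rayleigh's principle: the ground state energy bounds the quadratic form from below. -/
lemma groundEnergy_rayleigh {M : ℤ} (V : ℤ → ℝ) {f : ℤ → ℝ} (hf : IsNeumann M f) :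
    0 ≤ ∑ n ∈ Finset.Icc 1 M, f n * (schrod V f n - groundEnergy M V * f n) := by
  rw [← dotProduct_sub_groundEnergy V hf]
  exact (posSemidef_sub_sInf_spectrum
    (neumannMat1_isHermitian (Finset.Icc 1 M) V)).dotProduct_mulVec_nonneg _

/-- A minimizer of the quadratic form solves the eigenvalue equation. -/
lemma schrod_eq_of_rayleigh_eq_zero {M : ℤ} (V : ℤ → ℝ) {f : ℤ → ℝ} (hf : IsNeumann M f)
    (h0 : ∑ n ∈ Finset.Icc 1 M, f n * (schrod V f n - groundEnergy M V * f n) = 0)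
    {n : ℤ} (hn : n ∈ Finset.Icc 1 M) :
    schrod V f n = groundEnergy M V * f n := by
  rw [← dotProduct_sub_groundEnergy V hf] at h0
  have h := congrFun (((posSemidef_sub_sInf_spectrum
    (neumannMat1_isHermitian (Finset.Icc 1 M) V)).dotProduct_mulVec_zero_iff _).1 h0) ⟨n, hn⟩
  simp only [sub_mulVec, Pi.sub_apply, neumannMat1_mulVec V hf, smul_mulVec, one_mulVec,
    Pi.smul_apply, smul_eq_mul, Pi.zero_apply] at h
  exact sub_eq_zero.1 h

/-- The operator on `[1, M]` is symmetric on functions with Neumann boundary conditions. -/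
lemma sum_mul_schrod_comm {M : ℤ} (V : ℤ → ℝ) {f g : ℤ → ℝ} (hf : IsNeumann M f)
    (hg : IsNeumann M g) :
    ∑ n ∈ Finset.Icc 1 M, f n * schrod V g n = ∑ n ∈ Finset.Icc 1 M, g n * schrod V f n := by
  have hT : (neumannMat1 (Finset.Icc 1 M) V)ᵀ = neumannMat1 (Finset.Icc 1 M) V := by
    simpa only [conjTranspose_eq_transpose_of_trivial] using
      (neumannMat1_isHermitian (Finset.Icc 1 M) V).eq
  have h : (fun j : Finset.Icc 1 M => f j) ⬝ᵥ
      (neumannMat1 (Finset.Icc 1 M) V *ᵥ fun j => g j) = (fun j : Finset.Icc 1 M => g j) ⬝ᵥ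
      (neumannMat1 (Finset.Icc 1 M) V *ᵥ fun j => f j) := by
    rw [dotProduct_mulVec, ← mulVec_transpose, hT, dotProduct_comm]
  simp only [dotProduct, neumannMat1_mulVec V hf, neumannMat1_mulVec V hg] at h
  rwa [Finset.sum_coe_sort (Finset.Icc 1 M) (fun j => f j * schrod V g j),
    Finset.sum_coe_sort (Finset.Icc 1 M) (fun j => g j * schrod V f j)] at h

/-- A positive Neumann solution of `(H - E) f = 0` on `[1, M]`; positivity includes the
boundary points `0` and `M + 1`. -/
structure IsGroundState (M : ℤ) (V : ℤ → ℝ) (E : ℝ) (f : ℤ → ℝ) : Prop where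
  neumann : IsNeumann M f
  pos : ∀ n, 0 ≤ n → n ≤ M + 1 → 0 < f n
  eq : ∀ n, 1 ≤ n → n ≤ M → schrod V f n = E * f n

/-- Perron–Frobenius: there is a positive ground state. -/
lemma exists_isGroundState {M : ℤ} (hM : 1 ≤ M) (V : ℤ → ℝ) :
    ∃ f, IsGroundState M V (groundEnergy M V) f := by
  have : Nonempty (Finset.Icc 1 M) := ⟨⟨1, by simp [hM]⟩⟩
  obtain ⟨u, hu0, hu⟩ := exists_mulVec_eq_sInf_spectrum
    (neumannMat1_isHermitian (Finset.Icc 1 M) V)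
  set g : ℤ → ℝ := fun n => u ⟨max 1 (min M n), by simp [hM]⟩ with hg
  have hgu : ∀ j : Finset.Icc 1 M, g j = u j := by
    rintro ⟨j, hj⟩
    rw [Finset.mem_Icc] at hj
    simp only [hg]
    congr 2
    lia
  have hgN : IsNeumann M g := by
    constructor <;> simp only [hg] <;> congr 2 <;> lia
  have hgeq : ∀ n ∈ Finset.Icc 1 M, schrod V g n = groundEnergy M V * g n := by
    intro n hn
    have h := congrFun hu ⟨n, hn⟩
    rw [← funext hgu, neumannMat1_mulVec V hgN] at h
    exact h
  set f : ℤ → ℝ := fun n => |g n| with hf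
  have hfN : IsNeumann M f := ⟨congrArg abs hgN.1, congrArg abs hgN.2⟩
  have hfsum : ∑ n ∈ Finset.Icc 1 M, f n * (schrod V f n - groundEnergy M V * f n) = 0 := by
    refine le_antisymm (Finset.sum_nonpos fun n hn => ?_) (groundEnergy_rayleigh V hfN)
    have h1 := hgeq n hn
    have h2 := le_abs_self (g n * g (n - 1))
    have h3 := le_abs_self (g n * g (n + 1))
    rw [abs_mul] at h2 h3
    have h4 := abs_mul_abs_self (g n)
    simp only [schrod, hf] at h1 ⊢
    linear_combination h2 + h3 + g n * h1 + (V n - groundEnergy M V) * h4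
  have hfeq := fun {n : ℤ} (hn : n ∈ Finset.Icc 1 M) => schrod_eq_of_rayleigh_eq_zero V hfN hfsum hn
  have hf0 : ∀ n, 0 ≤ f n := fun n => abs_nonneg _
  have hstep : ∀ n ∈ Finset.Icc 1 M, f n = 0 → f (n - 1) = 0 ∧ f (n + 1) = 0 := by
    intro n hn h
    have h1 := hfeq hn
    rw [schrod, h] at h1
    constructor <;> linarith [hf0 (n - 1), hf0 (n + 1)]
  have hpos : ∀ n ∈ Finset.Icc 1 M, 0 < f n := by
    intro k hk
    refine (hf0 k).lt_of_ne' fun h => hu0 ?_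
    rw [Finset.mem_Icc] at hk
    have hup : ∀ n, k ≤ n → n ≤ M → f n = 0 := by
      intro n hn
      induction n, hn using Int.leInduction with
      | base => exact fun _ => h
      | succ n hn ih =>
        exact fun hle => (hstep n (Finset.mem_Icc.2 (by lia)) (ih (by lia))).2
    have hdown : ∀ n, n ≤ k → 1 ≤ n → f n = 0 := by
      intro n hn
      induction n, hn using Int.leInductionDown with
      | base => exact fun _ => h
      | pred n hn ih =>
        exact fun hle => (hstep n (Finset.mem_Icc.2 (by lia)) (ih (by lia))).1
    funext j
    have hj := Finset.mem_Icc.1 j.2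
    rw [← hgu, Pi.zero_apply, ← abs_eq_zero]
    rcases le_total k j with h' | h'
    · exact hup _ h' hj.2
    · exact hdown _ h' hj.1
  refine ⟨f, hfN, fun n h0 h1 => ?_, fun n h0 h1 => hfeq (Finset.mem_Icc.2 ⟨h0, h1⟩)⟩
  rcases h0.eq_or_lt with rfl | h0
  · exact hfN.1 ▸ hpos 1 (by simp [hM])
  rcases h1.eq_or_lt with rfl | h1
  · exact hfN.2 ▸ hpos M (by simp [hM])
  exact hpos n (Finset.mem_Icc.2 (by lia))

/-- The energy of a positive eigenfunction is the ground state energy. -/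
lemma IsGroundState.energy_eq {M : ℤ} {V : ℤ → ℝ} {E : ℝ} {f : ℤ → ℝ} (hM : 1 ≤ M)
    (hf : IsGroundState M V E f) : E = groundEnergy M V := by
  obtain ⟨g, hg⟩ := exists_isGroundState hM V
  have h := sum_mul_schrod_comm V hg.neumann hf.neumann
  have h1 : ∑ n ∈ Finset.Icc 1 M, (E - groundEnergy M V) * (g n * f n) = 0 := by
    rw [← sub_eq_zero, ← Finset.sum_sub_distrib] at h
    rw [← h]
    refine Finset.sum_congr rfl fun n hn => ?_
    rw [Finset.mem_Icc] at hn
    rw [hf.eq n hn.1 hn.2, hg.eq n hn.1 hn.2]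
    ring
  rw [← Finset.mul_sum, mul_eq_zero, sub_eq_zero] at h1
  refine h1.resolve_right (Finset.sum_pos (fun n hn => ?_) ⟨1, by simp [hM]⟩).ne'
  rw [Finset.mem_Icc] at hn
  exact mul_pos (hg.pos n (by lia) (by lia)) (hf.pos n (by lia) (by lia))

/-- To the left of the support of the potential, a ground state is monotone towards the support:
decreasing if `E > -2`, increasing if `E < -2`. -/
lemma IsGroundState.left_step {M a : ℤ} {V : ℤ → ℝ} {E : ℝ} {f : ℤ → ℝ}
    (hf : IsGroundState M V E f) (haM : a ≤ M) (hV : ∀ n ≤ a, V n = 0) (n : ℤ) (hn : 0 ≤ n) :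
    n ≤ a → (E + 2) * (f (n + 1) - f n) ≤ 0 := by
  induction n, hn using Int.leInduction with
  | base => intro _; rw [zero_add, hf.neumann.1, sub_self, mul_zero]
  | succ n hn ih =>
    intro hna
    have h := hf.eq (n + 1) (by lia) (by lia)
    rw [schrod, hV _ hna, add_sub_cancel_right] at h
    have h1 := mul_nonneg (sq_nonneg (E + 2)) (hf.pos (n + 1) (by lia) (by lia)).le
    linear_combination ih (by lia) + h1 - (E + 2) * h

lemma IsGroundState.left_le {M a : ℤ} {V : ℤ → ℝ} {E : ℝ} {f : ℤ → ℝ}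
    (hf : IsGroundState M V E f) (haM : a ≤ M) (hV : ∀ n ≤ a, V n = 0) (n : ℤ) (hn : 1 ≤ n) :
    n ≤ a + 1 → (E + 2) * f n ≤ (E + 2) * f 1 := by
  induction n, hn using Int.leInduction with
  | base => exact fun _ => le_rfl
  | succ n hn ih =>
    intro hna
    linear_combination ih (by lia) + hf.left_step haM hV n (by lia) (by lia)

/-- If the potential is reflection symmetric on a terminal segment `[m, M]` of the box, then the
ground state at the two ends of that segment is ordered according to the sign of `E + 2`. -/
lemma IsGroundState.sq_le_of_symm {M m : ℤ} {V : ℤ → ℝ} {E : ℝ} {f : ℤ → ℝ}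
    (hf : IsGroundState M V E f) (hm : 1 ≤ m) (hmM : m ≤ M)
    (hV : ∀ n, m ≤ n → n ≤ M → V (m + M - n) = V n)
    (hstep : (E + 2) * (f m - f (m - 1)) ≤ 0) :
    (E + 2) * f M ^ 2 ≤ (E + 2) * f m ^ 2 := by
  set w : ℤ → ℝ := fun n => f (m + M - n) with hw
  have hwr : ∀ n, m - 1 ≤ n → n ≤ M →
      0 ≤ (E + 2) * (f n * w (n + 1) - f (n + 1) * w n) := by
    intro n hn
    induction n, hn using Int.leInduction with
    | base =>
      intro _
      have h1 : w (m - 1 + 1) = f M := by simp only [hw]; congr 1; lia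
      have h2 : w (m - 1) = f M := by rw [← hf.neumann.2]; simp only [hw]; congr 1; lia
      rw [h1, h2, sub_add_cancel]
      have := mul_nonneg (neg_nonneg.2 hstep) (hf.pos M (by lia) (by lia)).le
      linear_combination this
    | succ n hn ih =>
      intro hnM
      have h1 := hf.eq (n + 1) (by lia) (by lia)
      have h2 := hf.eq (m + M - (n + 1)) (by lia) (by lia)
      rw [schrod, hV _ (by lia) hnM, show m + M - (n + 1) - 1 = m + M - (n + 1 + 1) by ring,
        show m + M - (n + 1) + 1 = m + M - n by ring] at h2
      rw [schrod, add_sub_cancel_right] at h1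
      have := ih (by lia)
      simp only [hw] at this ⊢
      linear_combination this - (E + 2) * (f (m + M - (n + 1)) * h1 - f (n + 1) * h2)
  have hratio : ∀ n, m ≤ n → n ≤ M → (E + 2) * (w m / f m) ≤ (E + 2) * (w n / f n) := by
    intro n hn
    induction n, hn using Int.leInduction with
    | base => exact fun _ => le_rfl
    | succ n hn ih =>
      intro hnM
      refine (ih (by lia)).trans ?_
      have h1 := hf.pos n (by lia) (by lia)
      have h2 := hf.pos (n + 1) (by lia) (by lia)
      rw [← sub_nonneg, ← mul_sub, div_sub_div _ _ h2.ne' h1.ne', ← mul_div_assoc]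
      refine div_nonneg ?_ (mul_pos h2 h1).le
      linear_combination hwr n (by lia) (by lia)
  have h := hratio M hmM le_rfl
  have h1 : w m = f M := by simp only [hw]; congr 1; lia
  have h2 : w M = f m := by simp only [hw]; congr 1; lia
  have hfM := hf.pos M (by lia) (by lia)
  have hfm := hf.pos m (by lia) (by lia)
  rw [h1, h2, ← mul_div_assoc, ← mul_div_assoc, div_le_div_iff₀ hfm hfM] at h
  linear_combination h

/-- Deleting the last site of the box and adding a site on the left lowers the energy as soon as
the ground state is suitably ordered at the two ends. -/
lemma IsGroundState.groundEnergy_shift_lt {M : ℤ} {V : ℤ → ℝ} {E : ℝ} {f : ℤ → ℝ}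
    (hf : IsGroundState M V E f) (hM : 3 ≤ M) (hV0 : V 0 = 0) (hVM : V M = 0)
    (h : (E + 2) * f (M - 1) ^ 2 < (E + 2) * f 1 ^ 2) :
    groundEnergy M (fun n => V (n - 1)) < E := by
  have hfM := hf.pos M (by lia) (by lia)
  have hfM1 := hf.pos (M - 1) (by lia) (by lia)
  have hf1 := hf.pos 1 (by lia) (by lia)
  have hM1 : f (M - 1) = (-1 - E) * f M := by
    have := hf.eq M (by lia) le_rfl
    rw [schrod, hVM, hf.neumann.2] at this
    linear_combination -this
  have hE : 0 < -1 - E := by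
    rw [hM1] at hfM1
    exact pos_of_mul_pos_left hfM1 hfM.le
  set g : ℤ → ℝ := fun n =>
    if n ≤ 1 then f 1 / (-1 - E) else if n ≤ M then f (n - 1) else f (M - 1) with hg
  have hgl : ∀ n ≤ 1, g n = f 1 / (-1 - E) := fun n hn => by simp [hg, hn]
  have hgm : ∀ n, 2 ≤ n → n ≤ M → g n = f (n - 1) := fun n h1 h2 => by
    simp [hg, h2, show ¬ n ≤ 1 by lia]
  have hgr : g (M + 1) = f (M - 1) := by simp [hg, show ¬ M + 1 ≤ 1 by lia]
  have hgN : IsNeumann M g :=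
    ⟨by rw [hgl 0 (by lia), hgl 1 le_rfl], by rw [hgr, hgm M (by lia) le_rfl]⟩
  have hsum : ∑ n ∈ Finset.Icc 1 M, g n * (schrod (fun n => V (n - 1)) g n - E * g n)
      = f 1 * (f 1 - f 1 / (-1 - E)) + f (M - 1) * (f M - f (M - 1)) := by
    rw [← Finset.sum_subset (s₁ := {2, M})]
    · rw [Finset.sum_pair (by lia)]
      have e2 := hf.eq 1 le_rfl (by lia)
      have eM := hf.eq (M - 1) (by lia) (by lia)
      norm_num [schrod] at e2 eM
      norm_num [schrod]
      rw [hgr, hgl 1 le_rfl, hgm 2 le_rfl (by lia), hgm 3 (by lia) hM, hgm M (by lia) le_rfl,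
        hgm (M - 1) (by lia) (by lia)]
      norm_num
      rw [← hf.neumann.1]
      rw [← hf.neumann.1] at e2
      linear_combination f 0 * e2 + f (M - 1) * eM
    · intro n hn
      simp only [Finset.mem_insert, Finset.mem_singleton] at hn
      rw [Finset.mem_Icc]
      lia
    · intro n hn hn2
      simp only [Finset.mem_insert, Finset.mem_singleton, not_or] at hn2
      rw [Finset.mem_Icc] at hn
      rw [mul_eq_zero]
      right
      rcases hn.1.eq_or_lt with rfl | h1
      · norm_num [schrod]
        rw [hV0, hgl 0 (by lia), hgl 1 le_rfl, hgm 2 le_rfl (by lia)]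
        norm_num
        field_simp
        ring
      · have e := hf.eq (n - 1) (by lia) (by lia)
        rw [schrod] at e ⊢
        rw [hgm n (by lia) (by lia), hgm (n - 1) (by lia) (by lia), hgm (n + 1) (by lia) (by lia),
          add_sub_cancel_right]
        rw [sub_add_cancel] at e
        linear_combination e
  have hneg : f 1 * (f 1 - f 1 / (-1 - E)) + f (M - 1) * (f M - f (M - 1)) < 0 := by
    have hfM' : f M = f (M - 1) / (-1 - E) := by rw [hM1]; field_simp
    have : f 1 * (f 1 - f 1 / (-1 - E)) + f (M - 1) * (f M - f (M - 1))
        = ((E + 2) * f (M - 1) ^ 2 - (E + 2) * f 1 ^ 2) / (-1 - E) := by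
      rw [hfM']
      field_simp
      ring
    rw [this]
    exact div_neg_of_neg_of_pos (sub_neg.2 h) hE
  by_contra! hle
  have hR := groundEnergy_rayleigh (fun n => V (n - 1)) hgN
  refine absurd hR (not_le.2 (lt_of_le_of_lt (Finset.sum_le_sum fun n _ => ?_) (hsum.trans_lt hneg)))
  linear_combination mul_le_mul_of_nonneg_right hle (mul_self_nonneg (g n))

/-- If the energy is `-2` for one position of the bubble, then it is so for every position. -/
lemma groundEnergy_eq_neg_two {M b : ℤ} (hb : 1 ≤ b) {q : ℤ → ℝ}
    (hsupp : ∀ n, n ∉ Finset.Icc 1 b → q n = 0) {a a' : ℤ} (ha : 0 ≤ a) (haM : a ≤ M - b)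
    (ha' : 0 ≤ a') (haM' : a' ≤ M - b)
    (h : groundEnergy M (fun n => q (n - a)) = -2) :
    groundEnergy M (fun n => q (n - a')) = -2 := by
  obtain ⟨f, hf⟩ := exists_isGroundState (M := M) (by lia) (fun n => q (n - a))
  rw [h] at hf
  have hq : ∀ n, n < 1 ∨ b < n → q n = 0 := fun n hn => hsupp n (by rw [Finset.mem_Icc]; lia)
  have hl : ∀ n, 0 ≤ n → n ≤ a → f (n + 1) = f n := by
    intro n hn
    induction n, hn using Int.leInduction with
    | base => exact fun _ => hf.neumann.1.symm
    | succ n hn ih =>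
      intro hna
      have e := hf.eq (n + 1) (by lia) (by lia)
      rw [schrod, hq _ (by lia), add_sub_cancel_right] at e
      linear_combination ih (by lia) - e
  have hr : ∀ n, n ≤ M → a + b ≤ n → f n = f (n + 1) := by
    intro n hn
    induction n, hn using Int.leInductionDown with
    | base => exact fun _ => hf.neumann.2.symm
    | pred n hn ih =>
      intro hna
      have e := hf.eq n (by lia) (by lia)
      rw [schrod, hq _ (by lia)] at e
      rw [sub_add_cancel]
      linear_combination ih (by lia) - e
  set g : ℤ → ℝ := fun n => f (a + max 1 (min b (n - a'))) with hg
  have hconst : ∀ n k, (n - a' ≤ 1 ∧ k - a' ≤ 1) ∨ (b ≤ n - a' ∧ b ≤ k - a') → g n = g k := by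
    intro n k hnk
    simp only [hg]
    congr 1
    lia
  refine (IsGroundState.energy_eq (M := M) (f := g) (by lia) ⟨⟨?_, ?_⟩, ?_, ?_⟩).symm
  · exact hconst _ _ (by lia)
  · exact hconst _ _ (by lia)
  · exact fun n h0 h1 => hf.pos _ (by lia) (by lia)
  · intro n h1 hM
    rw [schrod]
    by_cases hn : n - a' < 1 ∨ b < n - a'
    · rw [hq _ hn, hconst (n - 1) n (by lia), hconst (n + 1) n (by lia)]
      ring
    · have e := hf.eq (a + (n - a')) (by lia) (by lia)
      rw [schrod, add_sub_cancel_left] at e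
      have e0 : g n = f (a + (n - a')) := by simp only [hg]; congr 1; lia
      have e1 : g (n - 1) = f (a + (n - a') - 1) := by
        by_cases h : n - a' = 1
        · rw [h, add_sub_cancel_right, ← hl a ha le_rfl]
          simp only [hg]; congr 1; lia
        · simp only [hg]; congr 1; lia
      have e2 : g (n + 1) = f (a + (n - a') + 1) := by
        by_cases h : n - a' = b
        · rw [h, ← hr (a + b) (by lia) le_rfl]
          simp only [hg]; congr 1; lia
        · simp only [hg]; congr 1; lia
      rw [e0, e1, e2]
      exact e

/-- **Bubbles tend to the corners** in dimension one.  If `q` is supported in `[1, b₁]`,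
reflection symmetric there (H1), and `E_0(a) ≠ -2` for at least one `a ∈ [0, M₁ - b₁]`,
then `a ↦ E_0(a)` is strictly decreasing on `[r₁, M₁ - b₁]`,
where `r₁ = ⌈(M₁ - b₁)/2⌉ = (M₁ - b₁ + 1)/2`. -/
theorem bubbles_tend_to_corners_1d
    (M b : ℤ) (hb : 1 ≤ b) (hbM : b ≤ M)
    (q : ℤ → ℝ)
    (hsupp : ∀ n, n ∉ Finset.Icc 1 b → q n = 0)
    (hH1 : ∀ x : ℤ, q x = q (b - x + 1))
    (hE : ∃ a : ℤ, 0 ≤ a ∧ a ≤ M - b ∧ E0₁ M q a ≠ -2) :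
    StrictAntiOn (E0₁ M q) (Set.Icc ((M - b + 1) / 2) (M - b)) := by
  have hq : ∀ n, n < 1 ∨ b < n → q n = 0 := fun n hn => hsupp n (by rw [Finset.mem_Icc]; lia)
  refine strictAntiOn_of_add_one_lt Set.ordConnected_Icc fun a _ ha ha1 => ?_
  rw [Set.mem_Icc] at ha ha1
  obtain ⟨a₀, ha₀, ha₀M, hE₀⟩ := hE
  have hne : groundEnergy M (fun n => q (n - a)) + 2 ≠ 0 := fun h =>
    hE₀ (groundEnergy_eq_neg_two hb hsupp (a := a) (by lia) (by lia) ha₀ ha₀M (by linarith))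
  obtain ⟨f, hf⟩ := exists_isGroundState (M := M) (by lia) (fun n => q (n - a))
  change groundEnergy M (fun n => q (n - (a + 1))) < groundEnergy M (fun n => q (n - a))
  generalize groundEnergy M (fun n => q (n - a)) = E at hne hf ⊢
  have hV : ∀ n ≤ a, q (n - a) = 0 := fun n hn => hq _ (by lia)
  have hVM : q (M - a) = 0 := hq _ (by lia)
  have hsymm := hf.sq_le_of_symm (m := 2 * a + b + 1 - M) (by lia) (by lia)
    (fun n _ _ => by rw [hH1 (n - a)]; congr 1; ring)
    (by simpa using hf.left_step (by lia) hV (2 * a + b + 1 - M - 1) (by lia) (by lia))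
  have hleft := hf.left_le (by lia) hV (2 * a + b + 1 - M) (by lia) (by lia)
  have hfm := hf.pos (2 * a + b + 1 - M) (by lia) (by lia)
  have hf1 := hf.pos 1 (by lia) (by lia)
  have hfM := hf.pos M (by lia) (by lia)
  have hfM1 := hf.pos (M - 1) (by lia) (by lia)
  have hM1 : f (M - 1) = (-1 - E) * f M := by
    have := hf.eq M (by lia) le_rfl
    rw [schrod, hVM, hf.neumann.2] at this
    linear_combination -this
  have hlast : 0 < (E + 2) ^ 2 * (f M * (f M + f (M - 1))) := by positivity
  have hlt := hf.groundEnergy_shift_lt (by lia) (hV 0 (by lia)) hVM (by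
    have h1 := mul_le_mul_of_nonneg_right hleft (add_pos hfm hf1).le
    linear_combination hlast + hsymm + h1 + (E + 2) * (f M + f (M - 1)) * hM1)
  convert hlt using 3 with n
  congr 1
  ring
end
end

section
/- Assume (H1) and that either (i) d ≥ 2 and q ≠ 0 is sign-definite, or (ii) d = 1 and E_0(a) := min σ(h^N_{0,Λ} + q_a) ≠ −2 for at least one a ∈ [0, M_1−b_1]. Then the configuration ω* is spectrally minimizing: for every ω ∈ Ω = Δ^{ℤ^d} one has min σ(h_{ω*}) ≤ min σ(h_ω). -/
open scoped BigOperators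

noncomputable section

/-- Points of the lattice `ℤ^d`. -/
abbrev Zd (d : ℕ) := Fin d → ℤ

/-- 1-norm distance on `ℤ^d`. -/
def dist1 {d : ℕ} (x y : Zd d) : ℤ := ∑ i, |x i - y i|

/-- The set of nearest neighbors of a point of `ℤ^d`. -/
def nbhd {d : ℕ} (n : Zd d) : Finset (Zd d) :=
  (Fintype.piFinset fun i => Finset.Icc (n i - 1) (n i + 1)).filter fun m => dist1 n m = 1

/-- A discrete box `∏ [lo i, hi i]`. -/
def dbox {d : ℕ} (lo hi : Zd d) : Finset (Zd d) :=
  Fintype.piFinset fun i => Finset.Icc (lo i) (hi i)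

/-- `n_S(i)`: the number of nearest neighbors of `i` lying outside `S`. -/
def nOut {d : ℕ} (S : Finset (Zd d)) (i : Zd d) : ℕ :=
  ((nbhd i).filter fun j => j ∉ S).card

/-- The matrix of the Neumann Laplacian `h^N_{0,S}` plus a potential `V` on the finite
set `S ⊂ ℤ^d`. -/
def neumannMat {d : ℕ} (S : Finset (Zd d)) (V : Zd d → ℝ) : Matrix S S ℝ :=
  fun i j => (if dist1 (i : Zd d) (j : Zd d) = 1 then (-1 : ℝ) else 0)
    + (if i = j then (V (i : Zd d) - (nOut S (i : Zd d) : ℝ)) else 0)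

/-- `E_0(a) = min σ(h^N_{0,Λ} + q_a)` for `Λ = ∏ [1, M i]`. -/
def E0 {d : ℕ} (M : Zd d) (q : Zd d → ℝ) (a : Zd d) : ℝ :=
  sInf (spectrum ℝ (neumannMat (dbox (fun _ => 1) M) (fun n => q (n - a))))

/-- `ℓ²(ℤ^d)` with real coefficients. -/
abbrev l2 (d : ℕ) := lp (fun _ : Zd d => ℝ) 2

/-- The displacement potential `V_ω = ∑_k q_{kM + ω_k}`, evaluated pointwise:
`V_ω(n) = ∑_k q(n - kM - ω_k)`. -/
def Vpot {d : ℕ} (M : Zd d) (q : Zd d → ℝ) (ω : Zd d → Zd d) (n : Zd d) : ℝ :=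
  ∑' k : Zd d, q (fun i => n i - k i * M i - ω k i)

/-- A displacement configuration is admissible if each `ω_k ∈ Δ = ∏ [0, M i - b i]`. -/
def adm {d : ℕ} (M b : Zd d) (ω : Zd d → Zd d) : Prop :=
  ∀ k i, 0 ≤ ω k i ∧ ω k i ≤ M i - b i

/-- The special configuration `ω*`: `(ω*_k)_i = 0` if `k_i` is even, `M_i - b_i` if odd. -/
def ωstar {d : ℕ} (M b : Zd d) : Zd d → Zd d :=
  fun k i => if Even (k i) then 0 else M i - b i

section Combinatorial

/-- One step up in direction `i`, clipped at the upper face of the box `∏ [1, M j]`. -/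
def bump {d : ℕ} (M : Zd d) (i : Fin d) (x : Zd d) : Zd d :=
  Function.update x i (min (x i + 1) (M i))

/-- The reflection of the `i`-th coordinate of the box `∏ [1, M j]`. -/
def reflectAt {d : ℕ} (M : Zd d) (i : Fin d) (x : Zd d) : Zd d :=
  Function.update x i (M i + 1 - x i)

/-- The Neumann quadratic form with potential `W` on the box `∏ [1, M j]`. -/
def boxForm {d : ℕ} (M : Zd d) (W f : Zd d → ℝ) : ℝ :=
  ∑ x ∈ dbox (fun _ => 1) M, (∑ i, (f (bump M i x) - f x) ^ 2 + W x * f x ^ 2)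

lemma mem_dbox_one {d : ℕ} {M x : Zd d} :
    x ∈ dbox (fun _ => 1) M ↔ ∀ i, 1 ≤ x i ∧ x i ≤ M i := by
  simp [dbox]

lemma Icc_int_succ {a b : ℤ} (h : a ≤ b + 1) :
    Finset.Icc a (b + 1) = insert (b + 1) (Finset.Icc a b) := by
  ext x; simp only [Finset.mem_Icc, Finset.mem_insert]; omega

lemma Ico_int_succ {a b : ℤ} (h : a ≤ b) :
    Finset.Ico a (b + 1) = insert b (Finset.Ico a b) := by
  ext x; simp only [Finset.mem_Ico, Finset.mem_insert]; omega

/-- Averaging over the fibers of a box in one direction. -/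
lemma sum_fiber {d : ℕ} {M : Zd d} (i : Fin d) (hM : 1 ≤ M i) (g : Zd d → ℝ) :
    ∑ x ∈ dbox (fun _ => 1) M, ∑ t ∈ Finset.Icc 1 (M i), g (Function.update x i t)
      = M i * ∑ x ∈ dbox (fun _ => 1) M, g x := by
  have h1 : ∑ x ∈ dbox (fun _ => 1) M, ∑ t ∈ Finset.Icc 1 (M i), g (Function.update x i t)
      = ∑ x ∈ dbox (fun _ => 1) M, ∑ t ∈ Finset.Icc 1 (M i), g x := by
    rw [← Finset.sum_product', ← Finset.sum_product']
    have key : ∀ p : Zd d × ℤ, p ∈ dbox (fun _ => 1) M ×ˢ Finset.Icc 1 (M i) →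
        (Function.update p.1 i p.2, p.1 i) ∈ dbox (fun _ => 1) M ×ˢ Finset.Icc 1 (M i) := by
      rintro ⟨x, t⟩ h
      simp only [Finset.mem_product, mem_dbox_one, Finset.mem_Icc] at h ⊢
      refine ⟨fun j => ?_, h.1 i⟩
      by_cases hj : j = i
      · subst hj; simpa using h.2
      · simpa [hj] using h.1 j
    refine Finset.sum_bij' (fun p _ => (Function.update p.1 i p.2, p.1 i))
      (fun p _ => (Function.update p.1 i p.2, p.1 i)) key key ?_ ?_ ?_
    · rintro ⟨x, t⟩ _; simp
    · rintro ⟨x, t⟩ _; simp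
    · rintro ⟨x, t⟩ _; simp
  rw [h1, Finset.mul_sum]
  refine Finset.sum_congr rfl fun x _ => ?_
  rw [Finset.sum_const, Int.card_Icc, nsmul_eq_mul]
  congr 1
  have : ((M i + 1 - 1).toNat : ℤ) = M i := by omega
  exact_mod_cast this

lemma sum_bump_eq {m : ℤ} (hm : 1 ≤ m) (g : ℤ → ℝ) :
    ∑ t ∈ Finset.Icc 1 m, (g (min (t + 1) m) - g t) ^ 2
      = ∑ t ∈ Finset.Ico 1 m, (g (t + 1) - g t) ^ 2 := by
  have h : Finset.Icc 1 m = insert m (Finset.Ico 1 m) := by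
    ext x; simp only [Finset.mem_Icc, Finset.mem_insert, Finset.mem_Ico]; omega
  rw [h, Finset.sum_insert (by simp)]
  rw [min_eq_right (by omega)]
  simp only [sub_self, ne_eq, OfNat.ofNat_ne_zero, not_false_eq_true, zero_pow, zero_add]
  refine Finset.sum_congr rfl fun t ht => ?_
  rw [Finset.mem_Ico] at ht
  rw [min_eq_left (by omega)]

lemma sum_steps_eq {r : ℤ → ℤ} {n : ℤ} (hn : 1 ≤ n)
    (hr : ∀ t, 1 ≤ t → t < n → r (t + 1) = r t ∨ r (t + 1) = r t + 1) (g : ℤ → ℝ) :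
    r 1 ≤ r n ∧ ∑ t ∈ Finset.Ico 1 n, (g (r (t + 1)) - g (r t)) ^ 2
      = ∑ t ∈ Finset.Ico (r 1) (r n), (g (t + 1) - g t) ^ 2 := by
  induction n, hn using Int.leInduction with
  | base => simp
  | succ k hk ih =>
    obtain ⟨h1, h2⟩ := ih fun t ht ht' => hr t ht (by omega)
    rw [Ico_int_succ hk, Finset.sum_insert (by simp), h2]
    rcases hr k hk (by omega) with h | h
    · rw [h]; simp [h1]
    · rw [h, Ico_int_succ h1, Finset.sum_insert (by simp)]
      exact ⟨by omega, rfl⟩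

/-- Monotone reparametrizations by unit steps do not increase the kinetic energy. -/
lemma sum_bump_comp_le {r : ℤ → ℤ} {m : ℤ} (hm : 1 ≤ m)
    (hr : ∀ t, 1 ≤ t → t < m → r (t + 1) = r t ∨ r (t + 1) = r t + 1)
    (h1 : 1 ≤ r 1) (h2 : r m ≤ m) (g : ℤ → ℝ) :
    ∑ t ∈ Finset.Icc 1 m, (g (r (min (t + 1) m)) - g (r t)) ^ 2
      ≤ ∑ t ∈ Finset.Icc 1 m, (g (min (t + 1) m) - g t) ^ 2 := by
  rw [sum_bump_eq hm g, sum_bump_eq hm (fun t => g (r t)), (sum_steps_eq hm hr g).2]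
  refine Finset.sum_le_sum_of_subset_of_nonneg ?_ fun _ _ _ => sq_nonneg _
  exact Finset.Ico_subset_Ico h1 h2

lemma sum_repeat (i : ℤ) (hi : 1 ≤ i) (p c : ℕ) (g : ℤ → ℝ) :
    ∑ n ∈ Finset.Icc 1 (i + p + c), g (max (min n i) (n - c))
      = ∑ n ∈ Finset.Icc 1 (i + p), g n + c * g i := by
  induction p with
  | zero =>
    induction c with
    | zero =>
      simp only [Nat.cast_zero, add_zero, zero_mul, sub_zero]
      refine Finset.sum_congr rfl fun n hn => ?_
      congr 1; omega
    | succ c ih =>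
      have e : i + ((0 : ℕ) : ℤ) + ((c + 1 : ℕ) : ℤ) = (i + ((0 : ℕ) : ℤ) + c) + 1 := by
        push_cast; ring
      rw [e, Icc_int_succ (by omega), Finset.sum_insert (by simp)]
      have : ∑ n ∈ Finset.Icc 1 (i + ((0 : ℕ) : ℤ) + c), g (max (min n i) (n - ((c + 1 : ℕ) : ℤ)))
          = ∑ n ∈ Finset.Icc 1 (i + ((0 : ℕ) : ℤ) + c), g (max (min n i) (n - c)) := by
        refine Finset.sum_congr rfl fun n hn => ?_
        rw [Finset.mem_Icc] at hn
        congr 1; omega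
      rw [this, ih]
      have e2 : max (min (i + ((0 : ℕ) : ℤ) + c + 1) i)
          (i + ((0 : ℕ) : ℤ) + c + 1 - ((c + 1 : ℕ) : ℤ)) = i := by omega
      rw [e2]; push_cast; ring
  | succ p ih =>
    have e : i + ((p + 1 : ℕ) : ℤ) + c = (i + p + c) + 1 := by push_cast; ring
    have e1 : i + ((p + 1 : ℕ) : ℤ) = (i + p) + 1 := by push_cast; ring
    rw [e, e1, Icc_int_succ (by omega), Finset.sum_insert (by simp), ih,
      Icc_int_succ (by omega), Finset.sum_insert (by simp)]
    have e2 : max (min (i + p + c + 1) i) (i + p + c + 1 - c) = i + p + 1 := by omega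
    rw [e2]; ring

/-- Variant of `sum_repeat` with integer bounds. -/
lemma sum_repeat_int {i N c : ℤ} (hi : 1 ≤ i) (hN : i ≤ N) (hc : 0 ≤ c) (g : ℤ → ℝ) :
    ∑ n ∈ Finset.Icc 1 (N + c), g (max (min n i) (n - c))
      = ∑ n ∈ Finset.Icc 1 N, g n + c * g i := by
  obtain ⟨p, hp⟩ := Int.eq_ofNat_of_zero_le (sub_nonneg.2 hN)
  obtain ⟨c, rfl⟩ := Int.eq_ofNat_of_zero_le hc
  obtain rfl : N = i + p := by omega
  exact_mod_cast sum_repeat i hi p c g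

/-- The layer maps used to push a bump of width `b` from position `a` to an end of `[1, L + b]`:
for `j ≤ a` the layers to the right of the bump are dropped and layer `j` is repeated, for `j > a`
the layers to the left are dropped and layer `j + b` is repeated. -/
def layerMap (a b L j n : ℤ) : ℤ :=
  if j ≤ a then max (min n j) (n - (L - a)) else a + max (min n (j + b - a)) (n - a)

lemma sum_layerMap {a b L : ℤ} (ha : 0 ≤ a) (haL : a ≤ L) (hb : 0 ≤ b) (g : ℤ → ℝ) :
    ∑ j ∈ Finset.Icc 1 L, ∑ n ∈ Finset.Icc 1 (L + b), g (layerMap a b L j n)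
      = L * ∑ n ∈ Finset.Icc 1 (L + b), g n := by
  have split : ∀ (u v w : ℤ) (G : ℤ → ℝ), 0 ≤ u → u ≤ v → 
      ∑ j ∈ Finset.Icc 1 v, G j = ∑ j ∈ Finset.Icc 1 u, G j + ∑ j ∈ Finset.Icc (u + 1) v, G j := by
    intro u v w G hu huv
    have : Finset.Icc 1 v = Finset.Icc 1 u ∪ Finset.Icc (u + 1) v := by
      ext x; simp only [Finset.mem_Icc, Finset.mem_union]; omega
    rw [this, Finset.sum_union]
    rw [Finset.disjoint_left]; intro x hx hx'
    rw [Finset.mem_Icc] at hx hx'; omega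
  have shift : ∀ (u v w : ℤ) (G : ℤ → ℝ),
      ∑ j ∈ Finset.Icc u v, G (j + w) = ∑ j ∈ Finset.Icc (u + w) (v + w), G j := by
    intro u v w G
    rw [← Finset.map_add_right_Icc, Finset.sum_map]; rfl
  have h1 : ∑ j ∈ Finset.Icc 1 a, ∑ n ∈ Finset.Icc 1 (L + b), g (layerMap a b L j n)
      = ∑ j ∈ Finset.Icc 1 a, (∑ n ∈ Finset.Icc 1 (a + b), g n + (L - a : ℤ) * g j) := by
    refine Finset.sum_congr rfl fun j hj => ?_
    rw [Finset.mem_Icc] at hj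
    rw [← sum_repeat_int hj.1 (by omega) (by omega)]
    rw [show a + b + (L - a) = L + b by ring]
    refine Finset.sum_congr rfl fun n _ => ?_
    rw [layerMap, if_pos hj.2]
  have h2 : ∑ j ∈ Finset.Icc (a + 1) L, ∑ n ∈ Finset.Icc 1 (L + b), g (layerMap a b L j n)
      = ∑ j ∈ Finset.Icc (a + 1) L, (∑ n ∈ Finset.Icc (a + 1) (L + b), g n + a * g (j + b)) := by
    refine Finset.sum_congr rfl fun j hj => ?_
    rw [Finset.mem_Icc] at hj
    have := sum_repeat_int (i := j + b - a) (N := L + b - a) (c := a) (by omega) (by omega) ha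
      (fun n => g (n + a))
    rw [show L + b - a + a = L + b by ring] at this
    rw [shift, show L + b - a + a = L + b by ring, show j + b - a + a = j + b by ring,
      add_comm 1 a] at this
    rw [← this]
    refine Finset.sum_congr rfl fun n _ => ?_
    rw [layerMap, if_neg (by omega), add_comm]
  rw [split a L 0 _ ha haL, h1, h2, Finset.sum_add_distrib, Finset.sum_add_distrib,
    ← Finset.mul_sum, ← Finset.mul_sum, shift (a + 1) L b, Finset.sum_const, Finset.sum_const,
    Int.card_Icc, Int.card_Icc, nsmul_eq_mul, nsmul_eq_mul]
  have c1 : (((a + 1 - 1).toNat : ℕ) : ℝ) = a := by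
    have : ((a + 1 - 1).toNat : ℤ) = a := by omega
    exact_mod_cast this
  have c2 : (((L + 1 - (a + 1)).toNat : ℕ) : ℝ) = L - a := by
    have : ((L + 1 - (a + 1)).toNat : ℤ) = L - a := by omega
    exact_mod_cast this
  have s1 := split (a + b) (L + b) 0 g (by omega) (by omega)
  have s2 := split a (L + b) 0 g (by omega) (by omega)
  rw [show a + b + 1 = a + 1 + b by ring] at s1
  rw [c1, c2]
  push_cast
  linear_combination (-(a : ℝ)) * s1 - ((L : ℝ) - a) * s2

lemma sum_update_le {d : ℕ} {M : Zd d} (i : Fin d) (hM : 1 ≤ M i) {G G' : Zd d → ℝ}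
    (h : ∀ x ∈ dbox (fun _ => 1) M, ∑ t ∈ Finset.Icc 1 (M i), G (Function.update x i t)
      ≤ ∑ t ∈ Finset.Icc 1 (M i), G' (Function.update x i t)) :
    ∑ x ∈ dbox (fun _ => 1) M, G x ≤ ∑ x ∈ dbox (fun _ => 1) M, G' x := by
  have h0 : (0 : ℝ) < M i := by exact_mod_cast hM
  refine le_of_mul_le_mul_left ?_ h0
  rw [← sum_fiber i hM, ← sum_fiber i hM]
  exact Finset.sum_le_sum h

lemma bump_update_of_ne {d : ℕ} {M : Zd d} {i j : Fin d} (h : j ≠ i) (x : Zd d) (t : ℤ) :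
    bump M j (Function.update x i t) = Function.update (bump M j x) i t := by
  simp only [bump, Function.update_of_ne h]
  rw [Function.update_comm h]

lemma bump_apply_of_ne {d : ℕ} {M : Zd d} {i j : Fin d} (h : j ≠ i) (x : Zd d) :
    bump M j x i = x i := by
  simp [bump, Function.update_of_ne h.symm]

lemma bump_update_self {d : ℕ} {M : Zd d} (i : Fin d) (x : Zd d) (t : ℤ) :
    bump M i (Function.update x i t) = Function.update x i (min (t + 1) (M i)) := by
  simp [bump]

lemma boxForm_split {d : ℕ} (M : Zd d) (i : Fin d) (W f : Zd d → ℝ) :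
    boxForm M W f = ∑ x ∈ dbox (fun _ => 1) M, (f (bump M i x) - f x) ^ 2
      + ∑ x ∈ dbox (fun _ => 1) M,
        (∑ j ∈ Finset.univ.erase i, (f (bump M j x) - f x) ^ 2 + W x * f x ^ 2) := by
  rw [boxForm, ← Finset.sum_add_distrib]
  refine Finset.sum_congr rfl fun x _ => ?_
  rw [← Finset.add_sum_erase _ _ (Finset.mem_univ i), add_assoc]

lemma boxForm_layer_sum_le {d : ℕ} {M : Zd d} (i : Fin d) (hM : 1 ≤ M i)
    (J : Finset ℤ) (r : ℤ → ℤ → ℤ)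
    (hr : ∀ j ∈ J, ∀ t, 1 ≤ t → t < M i → r j (t + 1) = r j t ∨ r j (t + 1) = r j t + 1)
    (h1 : ∀ j ∈ J, 1 ≤ r j 1) (h2 : ∀ j ∈ J, r j (M i) ≤ M i)
    (hmass : ∀ g : ℤ → ℝ, ∑ j ∈ J, ∑ n ∈ Finset.Icc 1 (M i), g (r j n)
      = J.card * ∑ n ∈ Finset.Icc 1 (M i), g n) (W f : Zd d → ℝ) :
    ∑ j ∈ J, boxForm M (fun x => W (Function.update x i (r j (x i))))
        (fun x => f (Function.update x i (r j (x i)))) ≤ J.card * boxForm M W f := by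
  simp only [boxForm_split M i]
  rw [Finset.sum_add_distrib, mul_add]
  refine add_le_add ?_ ?_
  · rw [← nsmul_eq_mul]
    refine Finset.sum_le_card_nsmul _ _ _ fun j hj => ?_
    refine sum_update_le i hM fun x _ => ?_
    simp only [bump_update_self, Function.update_self, Function.update_idem]
    exact sum_bump_comp_le hM (hr j hj) (h1 j hj) (h2 j hj)
      (fun t => f (Function.update x i t))
  · rw [Finset.sum_comm, Finset.mul_sum]
    refine sum_update_le i hM fun x _ => ?_
    rw [Finset.sum_comm, ← Finset.mul_sum, ← hmass]
    refine le_of_eq (Finset.sum_congr rfl fun j _ => Finset.sum_congr rfl fun n _ => ?_)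
    simp only [Function.update_self, Function.update_idem]
    congr 1
    refine Finset.sum_congr rfl fun k hk => ?_
    have hk := Finset.ne_of_mem_erase hk
    simp only [bump_update_of_ne hk, bump_apply_of_ne hk, Function.update_self,
      Function.update_idem]

lemma boxForm_reflectAt {d : ℕ} {M : Zd d} (i : Fin d) (hM : 1 ≤ M i) (W f : Zd d → ℝ) :
    boxForm M (fun x => W (reflectAt M i x)) (fun x => f (reflectAt M i x)) = boxForm M W f := by
  have refl : ∀ (u v : ℤ) (g : ℤ → ℝ),
      ∑ t ∈ Finset.Icc u v, g (u + v - t) = ∑ t ∈ Finset.Icc u v, g t := by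
    intro u v g
    refine Finset.sum_bij' (fun t _ => u + v - t) (fun t _ => u + v - t) ?_ ?_ ?_ ?_ ?_
    all_goals intro t ht
    all_goals simp only [Finset.mem_Icc] at *
    all_goals omega
  have h0 : (0 : ℝ) < M i := by exact_mod_cast hM
  refine mul_left_cancel₀ h0.ne' ?_
  rw [boxForm_split M i, boxForm_split M i, mul_add, mul_add]
  simp only [← sum_fiber i hM]
  simp only [← Finset.sum_add_distrib]
  refine Finset.sum_congr rfl fun x _ => ?_
  simp only [Finset.sum_add_distrib (s := Finset.Icc 1 (M i))]
  simp only [bump_update_self, reflectAt, Function.update_self, Function.update_idem]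
  congr 1
  · rw [sum_bump_eq hM (fun t => f (Function.update x i (M i + 1 - t))),
      sum_bump_eq hM (fun t => f (Function.update x i t))]
    have e : Finset.Ico 1 (M i) = Finset.Icc 1 (M i - 1) := by
      ext x; simp only [Finset.mem_Icc, Finset.mem_Ico]; omega
    rw [e, ← refl 1 (M i - 1)]
    refine Finset.sum_congr rfl fun t _ => ?_
    rw [show M i + 1 - (1 + (M i - 1) - t + 1) = t by ring,
      show M i + 1 - (1 + (M i - 1) - t) = t + 1 by ring]
    ring
  · rw [← Finset.sum_add_distrib, ← Finset.sum_add_distrib, ← refl 1 (M i)]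
    refine Finset.sum_congr rfl fun t _ => ?_
    have e : M i + 1 - (1 + M i - t) = t := by ring
    congr 1
    · refine Finset.sum_congr rfl fun k hk => ?_
      have hk := Finset.ne_of_mem_erase hk
      simp only [bump_update_of_ne hk, bump_apply_of_ne hk, Function.update_self,
        Function.update_idem, e]
    · simp only [e]

/-- The simultaneous reflection of the coordinates in `s`. -/
def reflectSet {d : ℕ} (M : Zd d) (s : Finset (Fin d)) (x : Zd d) : Zd d :=
  fun i => if i ∈ s then M i + 1 - x i else x i

lemma reflectSet_empty {d : ℕ} (M x : Zd d) : reflectSet M ∅ x = x := by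
  funext i; simp [reflectSet]

lemma reflectSet_insert {d : ℕ} (M : Zd d) {s : Finset (Fin d)} {i : Fin d} (hi : i ∉ s)
    (x : Zd d) : reflectSet M (insert i s) x = reflectAt M i (reflectSet M s x) := by
  funext j
  by_cases h : j = i
  · subst h; simp [reflectSet, reflectAt, hi]
  · simp [reflectSet, reflectAt, h]

lemma boxForm_reflectSet {d : ℕ} {M : Zd d} (hM : ∀ i, 1 ≤ M i) (s : Finset (Fin d))
    (W f : Zd d → ℝ) :
    boxForm M (fun x => W (reflectSet M s x)) (fun x => f (reflectSet M s x))
      = boxForm M W f := by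
  induction s using Finset.induction_on generalizing W f with
  | empty => simp only [reflectSet_empty]
  | insert i s hi ih =>
    simp only [reflectSet_insert M hi]
    rw [ih (fun x => W (reflectAt M i x)) (fun x => f (reflectAt M i x)),
      boxForm_reflectAt i (hM i)]

/-- Invariance of `q` under reflections of its own support box. -/
lemma reflectSet_invariant {d : ℕ} {b : Zd d} {q : Zd d → ℝ}
    (hH1 : ∀ (x : Zd d) (i : Fin d), q x = q (Function.update x i (b i - x i + 1)))
    (s : Finset (Fin d)) (x : Zd d) : q (reflectSet b s x) = q x := by
  induction s using Finset.induction_on with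
  | empty => simp only [reflectSet_empty]
  | insert i s hi ih =>
    rw [reflectSet_insert b hi, ← ih, hH1 (reflectSet b s x) i, reflectAt]
    congr 2; ring

lemma boxForm_nonneg_of_update_zero {d : ℕ} {M b : Zd d} (hb : ∀ i, 1 ≤ b i)
    (hbM : ∀ i, b i ≤ M i) {q : Zd d → ℝ} (hsupp : ∀ n, n ∉ dbox (fun _ => 1) b → q n = 0)
    (hH1 : ∀ (x : Zd d) (i : Fin d), q x = q (Function.update x i (b i - x i + 1)))
    (E : ℝ) (a : Zd d) (i : Fin d) (h0 : 0 ≤ a i) (hL : a i ≤ M i - b i)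
    (h : ∀ f, 0 ≤ boxForm M (fun x => q (x - Function.update a i 0) - E) f) (f : Zd d → ℝ) :
    0 ≤ boxForm M (fun x => q (x - a) - E) f := by
  have hMi : 1 ≤ M i := (hb i).trans (hbM i)
  have h' : ∀ f, 0 ≤ boxForm M (fun x => q (x - Function.update a i (M i - b i)) - E) f := by
    intro f
    rw [← boxForm_reflectAt i hMi]
    convert h (fun x => f (reflectAt M i x)) using 3 with x
    rw [hH1 (x - Function.update a i 0) i]
    congr 2
    funext j
    by_cases hj : j = i
    · subst hj; simp [reflectAt]; ring
    · simp [reflectAt, hj]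
  set L := M i - b i with hLdef
  rcases eq_or_lt_of_le (h0.trans hL) with hL0 | hLpos
  · have : Function.update a i 0 = a := by
      rw [show (0 : ℤ) = a i by omega, Function.update_eq_self]
    rw [← this]; exact h f
  have hML : M i = L + b i := by omega
  have key := boxForm_layer_sum_le (M := M) i hMi (Finset.Icc 1 L) (layerMap (a i) (b i) L)
    (by
      intro j hj t _ _
      rw [Finset.mem_Icc] at hj
      unfold layerMap; split_ifs <;> omega)
    (by
      intro j hj
      rw [Finset.mem_Icc] at hj
      have := hb i
      unfold layerMap; split_ifs <;> omega)
    (by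
      intro j hj
      rw [Finset.mem_Icc] at hj
      have := hb i
      unfold layerMap; split_ifs <;> omega)
    (by
      intro g
      rw [hML, sum_layerMap h0 hL (by linarith [hb i])]
      congr 1
      rw [Int.card_Icc]
      have : ((L + 1 - 1).toNat : ℤ) = L := by omega
      exact_mod_cast this.symm)
    (fun x => q (x - a) - E) f
  have hcard : (0 : ℝ) < (Finset.Icc 1 L).card := by
    rw [Int.card_Icc]; exact_mod_cast (by omega : 0 < (L + 1 - 1).toNat)
  refine nonneg_of_mul_nonneg_right (le_trans (Finset.sum_nonneg fun j hj => ?_) key) hcard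
  rw [Finset.mem_Icc] at hj
  have qz : ∀ y : Zd d, (y i ≤ 0 ∨ b i < y i) → q y = 0 := by
    intro y hy
    refine hsupp y fun hy' => ?_
    have := mem_dbox_one.1 hy' i
    omega
  by_cases hja : j ≤ a i
  · convert h' (fun x => f (Function.update x i (layerMap (a i) (b i) L j (x i)))) using 3 with x
    congr 1
    refine congrArg (· - E) ?_
    by_cases hx : L < x i
    · refine congrArg q ?_
      funext k
      by_cases hk : k = i
      · subst hk; simp only [Pi.sub_apply, Function.update_self, layerMap, if_pos hja]; omega
      · simp [hk]
    · rw [qz, qz]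
      · left; simp only [Pi.sub_apply, Function.update_self]; omega
      · left; simp only [Pi.sub_apply, Function.update_self, layerMap, if_pos hja]; omega
  · convert h (fun x => f (Function.update x i (layerMap (a i) (b i) L j (x i)))) using 3 with x
    congr 1
    refine congrArg (· - E) ?_
    by_cases hx : x i ≤ b i
    · refine congrArg q ?_
      funext k
      by_cases hk : k = i
      · subst hk; simp only [Pi.sub_apply, Function.update_self, layerMap, if_neg hja]; omega
      · simp [hk]
    · rw [qz, qz]
      · right; simp only [Pi.sub_apply, Function.update_self]; omega
      · right; simp only [Pi.sub_apply, Function.update_self, layerMap, if_neg hja]; omega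

/-- Bubbles tend to the corners: the corner position is optimal for the Neumann form. -/
lemma boxForm_nonneg_of_corner {d : ℕ} {M b : Zd d} (hb : ∀ i, 1 ≤ b i)
    (hbM : ∀ i, b i ≤ M i) {q : Zd d → ℝ} (hsupp : ∀ n, n ∉ dbox (fun _ => 1) b → q n = 0)
    (hH1 : ∀ (x : Zd d) (i : Fin d), q x = q (Function.update x i (b i - x i + 1)))
    (E : ℝ) (h : ∀ f, 0 ≤ boxForm M (fun x => q x - E) f)
    (a : Zd d) (ha : ∀ i, 0 ≤ a i ∧ a i ≤ M i - b i) (f : Zd d → ℝ) :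
    0 ≤ boxForm M (fun x => q (x - a) - E) f := by
  have key : ∀ s : Finset (Fin d), ∀ f, 0 ≤ boxForm M
      (fun x => q (x - fun i => if i ∈ s then a i else 0) - E) f := by
    intro s
    induction s using Finset.induction_on with
    | empty =>
      intro f
      convert h f using 5 with x
      funext i; simp
    | insert i s hi ih =>
      refine boxForm_nonneg_of_update_zero hb hbM hsupp hH1 E _ i
        (by simpa using (ha i).1) (by simpa using (ha i).2) ?_
      have : Function.update (fun j => if j ∈ insert i s then a j else 0) i 0
          = fun j => if j ∈ s then a j else 0 := by
        funext j
        by_cases hj : j = i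
        · subst hj; simp [hi]
        · simp [hj]
      rw [this]; exact ih
  simpa using key Finset.univ f

end Combinatorial

section Spectrum

variable {V : Type*} [NormedAddCommGroup V] [InnerProductSpace ℝ V]

/-- Points below a lower bound of the quadratic form are not in the spectrum. -/
lemma le_of_mem_spectrum [CompleteSpace V] {T : V →L[ℝ] V} {m : ℝ}
    (hm : ∀ u, m * ‖u‖ ^ 2 ≤ inner ℝ (T u) u) {l : ℝ} (hl : l ∈ spectrum ℝ T) : m ≤ l := by
  by_contra! hlt
  refine hl ?_
  let A : V →L[ℝ] V := T - l • (1 : V →L[ℝ] V)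
  have hA : IsCoercive ((innerSL ℝ).comp A) := by
    refine ⟨m - l, by linarith, fun u => ?_⟩
    have : ((innerSL ℝ).comp A) u u = inner ℝ (T u) u - l * ‖u‖ ^ 2 := by
      simp [A]
    rw [this]
    nlinarith [hm u]
  have hAeq : ((hA.continuousLinearEquivOfBilin : V ≃L[ℝ] V) : V →L[ℝ] V) = A := by
    ext v
    refine (hA.unique_continuousLinearEquivOfBilin fun w => ?_).symm
    simp
  have hu : IsUnit A := by
    rw [← hAeq]
    exact ⟨ContinuousLinearEquiv.toUnit _, rfl⟩
  rw [spectrum.mem_resolventSet_iff, ← IsUnit.neg_iff]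
  convert hu using 1
  simp [A, Algebra.algebraMap_eq_smul_one]

/-- An invertible nonnegative symmetric operator is bounded below. -/
lemma exists_pos_le_of_isUnit {A : V →L[ℝ] V} (hs : ∀ u v, inner ℝ (A u) v = inner ℝ u (A v))
    (hA : ∀ u, 0 ≤ inner ℝ (A u) u) (hu : IsUnit A) :
    ∃ c > 0, ∀ u, c * ‖u‖ ^ 2 ≤ inner ℝ (A u) u := by
  obtain ⟨U, rfl⟩ := hu
  set B : V →L[ℝ] V := ((U⁻¹ : (V →L[ℝ] V)ˣ) : V →L[ℝ] V) with hB
  have hAB : ∀ u, (U : V →L[ℝ] V) (B u) = u := fun u => by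
    have : (U : V →L[ℝ] V) * B = 1 := U.mul_inv
    exact DFunLike.congr_fun this u
  refine ⟨(‖B‖ + 1)⁻¹, by positivity, fun u => ?_⟩
  have hBpos : 0 < ‖B‖ + 1 := by positivity
  have h1 : ∀ t : ℝ, 0 ≤ inner ℝ ((U : V →L[ℝ] V) u) u * (t * t) + (2 * ‖u‖ ^ 2) * t
      + inner ℝ u (B u) := by
    intro t
    have := hA (B u + t • u)
    have e : inner ℝ ((U : V →L[ℝ] V) (B u + t • u)) (B u + t • u)
        = inner ℝ ((U : V →L[ℝ] V) u) u * (t * t) + (2 * ‖u‖ ^ 2) * t + inner ℝ u (B u) := by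
      rw [map_add, map_smul, hAB]
      simp only [inner_add_left, inner_add_right, real_inner_smul_left, real_inner_smul_right]
      rw [hs u (B u), hAB, real_inner_self_eq_norm_sq]
      ring
    rwa [e] at this
  have h2 := discrim_le_zero h1
  rw [discrim] at h2
  have h3 : inner ℝ u (B u) ≤ (‖B‖ + 1) * ‖u‖ ^ 2 := by
    have a1 := real_inner_le_norm u (B u)
    have a2 := B.le_opNorm u
    nlinarith [norm_nonneg u]
  rw [inv_mul_le_iff₀ hBpos]
  rcases eq_or_lt_of_le (norm_nonneg u) with h0 | h0
  · rw [← h0]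
    have := hA u
    simpa using mul_nonneg hBpos.le this
  · have h4 : ‖u‖ ^ 2 * ‖u‖ ^ 2 ≤ ((‖B‖ + 1) * inner ℝ ((U : V →L[ℝ] V) u) u) * ‖u‖ ^ 2 := by
      nlinarith [mul_le_mul_of_nonneg_left h3 (hA u)]
    exact le_of_mul_le_mul_right h4 (by positivity)

/-- The infimum of the quadratic form of a symmetric operator is the least spectral value. -/
lemma exists_isLeast_spectrum [CompleteSpace V] [Nontrivial V] {T : V →L[ℝ] V}
    (hs : ∀ u v, inner ℝ (T u) v = inner ℝ u (T v)) :
    ∃ m, (∀ u, m * ‖u‖ ^ 2 ≤ inner ℝ (T u) u) ∧ IsLeast (spectrum ℝ T) m := by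
  set R : Set ℝ := {r | ∀ u, r * ‖u‖ ^ 2 ≤ inner ℝ (T u) u} with hR
  have hne : R.Nonempty := by
    refine ⟨-‖T‖, fun u => ?_⟩
    have a1 := abs_real_inner_le_norm (T u) u
    have a2 := T.le_opNorm u
    have a3 := neg_abs_le (inner ℝ (T u) u)
    nlinarith [norm_nonneg u]
  obtain ⟨w, hw⟩ := exists_ne (0 : V)
  have hw' : 0 < ‖w‖ ^ 2 := by positivity
  have hbdd : BddAbove R := by
    refine ⟨inner ℝ (T w) w / ‖w‖ ^ 2, fun r hr => ?_⟩
    rw [le_div_iff₀ hw']; exact hr w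
  have hm : ∀ u, sSup R * ‖u‖ ^ 2 ≤ inner ℝ (T u) u := by
    intro u
    rcases eq_or_ne u 0 with rfl | hu
    · simp
    · have : 0 < ‖u‖ ^ 2 := by positivity
      rw [← le_div_iff₀ this]
      refine csSup_le hne fun r hr => ?_
      rw [le_div_iff₀ this]; exact hr u
  refine ⟨sSup R, hm, ?_, fun l hl => le_of_mem_spectrum hm hl⟩
  intro hunit
  have hu : IsUnit (T - sSup R • (1 : V →L[ℝ] V)) := by
    rw [← IsUnit.neg_iff]
    convert spectrum.mem_resolventSet_iff.1 hunit using 1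
    simp [Algebra.algebraMap_eq_smul_one]
  have hinner : ∀ u v, inner ℝ ((T - sSup R • (1 : V →L[ℝ] V)) u) v
      = inner ℝ (T u) v - sSup R * inner ℝ u v := by
    intro u v
    simp [inner_sub_left, inner_smul_left]
  obtain ⟨c, hc, hcu⟩ := exists_pos_le_of_isUnit (A := T - sSup R • (1 : V →L[ℝ] V))
    (fun u v => by
      rw [hinner, real_inner_comm ((T - sSup R • (1 : V →L[ℝ] V)) v) u, hinner, hs,
        real_inner_comm (T v) u, real_inner_comm u v])
    (fun u => by
      rw [hinner, real_inner_self_eq_norm_sq]; linarith [hm u]) hu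
  have : sSup R + c ∈ R := fun u => by
    have := hcu u
    rw [hinner, real_inner_self_eq_norm_sq] at this
    linarith
  linarith [le_csSup hbdd this]

end Spectrum

section Lattice

open Finset in
lemma sum_nbhd {d : ℕ} (n : Zd d) (u : Zd d → ℝ) :
    ∑ j ∈ nbhd n, u j = ∑ i, (u (n + Pi.single i 1) + u (n - Pi.single i 1)) := by
  have hdist : ∀ (i : Fin d) (c : ℤ), dist1 n (n + Pi.single i c) = |c| := by
    intro i c
    rw [dist1, Finset.sum_eq_single i]
    · simp
    · intro j _ hj; simp [hj]
    · simp
  have hmem : ∀ m, m ∈ nbhd n ↔ dist1 n m = 1 := by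
    intro m
    rw [nbhd, Finset.mem_filter, Fintype.mem_piFinset]
    refine ⟨fun h => h.2, fun h => ⟨fun i => ?_, h⟩⟩
    have : |n i - m i| ≤ dist1 n m :=
      Finset.single_le_sum (f := fun i => |n i - m i|) (fun _ _ => abs_nonneg _)
        (Finset.mem_univ i)
    rw [h, abs_le] at this
    rw [Finset.mem_Icc]; omega
  have hset : nbhd n = (univ : Finset (Fin d × Bool)).image
      (fun p => n + Pi.single p.1 (if p.2 then 1 else -1)) := by
    ext m
    rw [hmem, Finset.mem_image]
    constructor
    · intro h
      have : ∃ i, n i ≠ m i := by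
        by_contra! hc
        simp [dist1, hc] at h
      obtain ⟨i, hi⟩ := this
      have hpos : 1 ≤ |n i - m i| := Int.one_le_abs (sub_ne_zero.2 hi)
      have hrest : 0 ≤ ∑ j ∈ univ.erase i, |n j - m j| :=
        Finset.sum_nonneg fun _ _ => abs_nonneg _
      rw [dist1, ← Finset.add_sum_erase _ _ (Finset.mem_univ i)] at h
      have h0 : ∑ j ∈ univ.erase i, |n j - m j| = 0 := by omega
      rw [Finset.sum_eq_zero_iff_of_nonneg fun _ _ => abs_nonneg _] at h0
      refine ⟨(i, decide (m i = n i + 1)), Finset.mem_univ _, ?_⟩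
      funext j
      by_cases hj : j = i
      · subst hj
        have : |n j - m j| = 1 := by omega
        rcases (abs_eq one_pos.le).1 this with h | h
        · have : m j ≠ n j + 1 := by omega
          simp [this]; omega
        · have : m j = n j + 1 := by omega
          simp [this]
      · have := h0 j (by simp [hj])
        rw [abs_eq_zero] at this
        simp [hj]; omega
    · rintro ⟨⟨i, c⟩, -, rfl⟩
      rw [hdist]; cases c <;> simp
  rw [hset, Finset.sum_image, Fintype.sum_prod_type]
  · simp [sub_eq_add_neg, Pi.single_neg]
  · rintro ⟨i, c⟩ - ⟨j, c'⟩ - h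
    have h := add_left_cancel h
    have hi := congrFun h i
    have hij : i = j := by
      by_contra hne
      cases c <;> cases c' <;> simp [hne] at hi
    subst hij
    cases c <;> cases c' <;> simp at hi <;> simp_all

lemma hasSum_sq_l2 {d : ℕ} (u : l2 d) : HasSum (fun n => u n ^ 2) (‖u‖ ^ 2) := by
  have := lp.hasSum_inner (𝕜 := ℝ) u u
  rw [real_inner_self_eq_norm_sq] at this
  refine this.congr_fun ?_
  intro n
  simp [pow_two]

lemma summable_shift_mul {d : ℕ} (u v : l2 d) (e : Zd d) : Summable fun n => u (n + e) * v n := by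
  have h1 : Summable fun n => u (n + e) ^ 2 :=
    ((Equiv.addRight e).summable_iff (f := fun n => u n ^ 2)).2 (hasSum_sq_l2 u).summable
  refine Summable.of_norm_bounded (h1.add (hasSum_sq_l2 v).summable) fun n => ?_
  rw [Real.norm_eq_abs, abs_le]
  constructor <;> nlinarith [sq_nonneg (u (n + e) + v n), sq_nonneg (u (n + e) - v n)]

lemma hasSum_shift_neg {d : ℕ} (u v : l2 d) (e : Zd d) :
    HasSum (fun n => u (n - e) * v n) (∑' n, v (n + e) * u n) := by
  rw [← (Equiv.addRight e).hasSum_iff]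
  convert (summable_shift_mul v u e).hasSum using 2 with n
  simp [mul_comm]

/-- `T` acts as the discrete Schrödinger operator with potential `V`. -/
def IsSchrodinger {d : ℕ} (T : l2 d →L[ℝ] l2 d) (V : Zd d → ℝ) : Prop :=
  ∀ (u : l2 d) (n : Zd d), (T u) n = (-∑ j ∈ nbhd n, u j) + V n * u n

lemma IsSchrodinger.symmetric {d : ℕ} {T : l2 d →L[ℝ] l2 d} {V : Zd d → ℝ}
    (hT : IsSchrodinger T V) (u v : l2 d) : inner ℝ (T u) v = inner ℝ u (T v) := by
  have h := (lp.hasSum_inner (𝕜 := ℝ) (T u) v).sub (lp.hasSum_inner (𝕜 := ℝ) u (T v))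
  have h0 : HasSum (fun n => inner ℝ ((T u) n) (v n) - inner ℝ (u n) ((T v) n))
      (∑ _i : Fin d, (0 : ℝ)) := by
    have : ∀ i : Fin d, HasSum (fun n => (v (n + Pi.single i 1) * u n - u (n - Pi.single i 1) * v n)
        + (v (n - Pi.single i 1) * u n - u (n + Pi.single i 1) * v n)) (0 : ℝ) := by
      intro i
      have := ((summable_shift_mul v u (Pi.single i 1)).hasSum.sub
        (hasSum_shift_neg u v (Pi.single i 1))).add
        ((hasSum_shift_neg v u (Pi.single i 1)).sub
          (summable_shift_mul u v (Pi.single i 1)).hasSum)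
      simpa using this
    refine (hasSum_sum fun i _ => this i).congr_fun fun n => ?_
    simp only [hT u n, hT v n, sum_nbhd, RCLike.inner_apply, conj_trivial]
    rw [mul_add, add_mul, mul_neg, neg_mul, Finset.mul_sum, Finset.sum_mul]
    have : ∀ A B C D E : ℝ, E = B - A → C = D → -A + C - (-B + D) = E := by
      intro A B C D E h1 h2; rw [h1, h2]; ring
    refine this _ _ _ _ _ ?_ (by ring)
    rw [← Finset.sum_sub_distrib]
    exact Finset.sum_congr rfl fun i _ => by ring
  have := h.unique h0
  simp only [Finset.sum_const_zero] at this
  linarith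

lemma IsSchrodinger.hasSum_form {d : ℕ} {T : l2 d →L[ℝ] l2 d} {V : Zd d → ℝ}
    (hT : IsSchrodinger T V) (E : ℝ) (u : l2 d) :
    HasSum (fun n => ∑ i, (u (n + Pi.single i 1) - u n) ^ 2 + (V n - (E + 2 * d)) * u n ^ 2)
      (inner ℝ (T u) u - E * ‖u‖ ^ 2) := by
  have hsq := hasSum_sq_l2 u
  have h1 : ∀ i : Fin d, HasSum (fun n => (u (n + Pi.single i 1) - u n) ^ 2 - 2 * u n ^ 2
      + (u (n + Pi.single i 1) * u n + u (n - Pi.single i 1) * u n)) (0 : ℝ) := by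
    intro i
    have hs : HasSum (fun n => u (n + Pi.single i 1) ^ 2) (‖u‖ ^ 2) :=
      ((Equiv.addRight (Pi.single i 1 : Zd d)).hasSum_iff (f := fun n => u n ^ 2)).2 hsq
    have := (hs.sub hsq).add ((hasSum_shift_neg u u (Pi.single i 1)).sub
      (summable_shift_mul u u (Pi.single i 1)).hasSum)
    simp only [sub_self, add_zero] at this
    exact this.congr_fun fun n => by ring
  have h2 := ((lp.hasSum_inner (𝕜 := ℝ) (T u) u).sub (hsq.mul_left E)).add
    (hasSum_sum fun i (_ : i ∈ Finset.univ) => h1 i)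
  simp only [Finset.sum_const_zero, add_zero] at h2
  refine h2.congr_fun fun n => ?_
  simp only [hT u n, sum_nbhd, RCLike.inner_apply, conj_trivial, Finset.sum_add_distrib,
    Finset.sum_sub_distrib, Finset.sum_const, Finset.card_univ, Fintype.card_fin, nsmul_eq_mul,
    ← Finset.sum_mul]
  ring

/-- The decomposition of the lattice into translates of the box `∏ [1, M i]`. -/
def cellEquiv {d : ℕ} {M : Zd d} (hM : ∀ i, 1 ≤ M i) :
    Zd d × {x // x ∈ dbox (fun _ => 1) M} ≃ Zd d where
  toFun p i := p.1 i * M i + p.2.1 i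
  invFun n := (fun i => (n i - 1) / M i, ⟨fun i => (n i - 1) % M i + 1, by
    rw [mem_dbox_one]
    intro i
    have h1 := Int.emod_nonneg (n i - 1) (by linarith [hM i] : M i ≠ 0)
    have h2 := Int.emod_lt_of_pos (n i - 1) (by linarith [hM i] : 0 < M i)
    omega⟩)
  left_inv := by
    rintro ⟨k, x, hx⟩
    rw [mem_dbox_one] at hx
    have e : ∀ i, k i * M i + x i - 1 = (x i - 1) + k i * M i := fun i => by ring
    ext i
    · have := hM i
      simp only [e]
      rw [Int.add_mul_ediv_right _ _ (by omega),
        Int.ediv_eq_zero_of_lt (by linarith [hx i]) (by linarith [hx i]), zero_add]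
    · simp only [e]
      rw [Int.add_mul_emod_self_right,
        Int.emod_eq_of_lt (by linarith [hx i]) (by linarith [hx i])]
      ring
  right_inv n := by
    funext i
    have := Int.mul_ediv_add_emod (n i - 1) (M i)
    simp only
    linarith [mul_comm (M i) ((n i - 1) / M i)]

lemma cellEquiv_apply {d : ℕ} {M : Zd d} (hM : ∀ i, 1 ≤ M i)
    (p : Zd d × {x // x ∈ dbox (fun _ => 1) M}) (i : Fin d) :
    cellEquiv hM p i = p.1 i * M i + p.2.1 i := rfl

lemma bump_mem {d : ℕ} {M : Zd d} (i : Fin d) {x : Zd d} (hx : x ∈ dbox (fun _ => 1) M) :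
    bump M i x ∈ dbox (fun _ => 1) M := by
  rw [mem_dbox_one] at hx ⊢
  intro j
  have := hx j
  by_cases hj : j = i
  · subst hj; simp only [bump, Function.update_self]; omega
  · simpa [bump, hj] using this

lemma cellEquiv_add_single_of_lt {d : ℕ} {M : Zd d} (hM : ∀ i, 1 ≤ M i) (k : Zd d)
    (x : {x // x ∈ dbox (fun _ => 1) M}) (i : Fin d) (h : x.1 i < M i) :
    cellEquiv hM (k, x) + Pi.single i 1 = cellEquiv hM (k, ⟨bump M i x.1, bump_mem i x.2⟩) := by
  funext j
  simp only [Pi.add_apply, cellEquiv_apply]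
  by_cases hj : j = i
  · subst hj; simp only [bump, Function.update_self, Pi.single_eq_same]
    rw [min_eq_left (by omega)]; ring
  · simp [bump, hj]

lemma cellEquiv_add_single_of_eq {d : ℕ} {M : Zd d} (hM : ∀ i, 1 ≤ M i) (k : Zd d)
    (x : {x // x ∈ dbox (fun _ => 1) M}) (i : Fin d) (h : x.1 i = M i) :
    ∃ hy : Function.update x.1 i 1 ∈ dbox (fun _ => 1) M,
      cellEquiv hM (k, x) + Pi.single i 1 = cellEquiv hM (k + Pi.single i 1, ⟨_, hy⟩) := by
  have hy : Function.update x.1 i 1 ∈ dbox (fun _ => 1) M := by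
    have hx := mem_dbox_one.1 x.2
    rw [mem_dbox_one]
    intro j
    by_cases hj : j = i
    · subst hj; simpa using hM j
    · simpa [hj] using hx j
  refine ⟨hy, ?_⟩
  funext j
  simp only [Pi.add_apply, cellEquiv_apply]
  by_cases hj : j = i
  · subst hj; simp only [Function.update_self, Pi.single_eq_same, h]; ring
  · simp [hj]

lemma bump_eq_self {d : ℕ} {M : Zd d} {i : Fin d} {x : Zd d} (h : x i = M i) :
    bump M i x = x := by
  rw [bump, min_eq_right (by omega), ← h, Function.update_eq_self]

lemma Vpot_cellEquiv {d : ℕ} {M b : Zd d} (hM : ∀ i, 1 ≤ M i) {q : Zd d → ℝ}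
    (hsupp : ∀ n, n ∉ dbox (fun _ => 1) b → q n = 0) {ω : Zd d → Zd d} (hω : adm M b ω)
    (k : Zd d) (x : {x // x ∈ dbox (fun _ => 1) M}) :
    Vpot M q ω (cellEquiv hM (k, x)) = q (x.1 - ω k) := by
  have hx := mem_dbox_one.1 x.2
  rw [Vpot, tsum_eq_single k]
  · congr 1
    funext i
    simp [cellEquiv_apply]
  · intro l hl
    refine hsupp _ fun hmem => ?_
    rw [mem_dbox_one] at hmem
    obtain ⟨i, hi⟩ := Function.ne_iff.1 hl
    have h1 := hmem i
    have h2 := hω l i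
    have h3 := hx i
    have h4 := hM i
    simp only [cellEquiv_apply] at h1
    have e : k i * M i - l i * M i = (k i - l i) * M i := by ring
    rcases lt_or_gt_of_ne hi with h | h
    · have : 1 * M i ≤ (k i - l i) * M i := mul_le_mul_of_nonneg_right (by omega) (by omega)
      omega
    · have : (k i - l i) * M i ≤ (-1) * M i := mul_le_mul_of_nonneg_right (by omega) (by omega)
      omega

/-- Neumann bracketing. -/
lemma IsSchrodinger.form_lower_bound {d : ℕ} {M b : Zd d} (hM : ∀ i, 1 ≤ M i) {q : Zd d → ℝ}
    (hsupp : ∀ n, n ∉ dbox (fun _ => 1) b → q n = 0) {ω : Zd d → Zd d} (hω : adm M b ω)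
    {T : l2 d →L[ℝ] l2 d} (hT : IsSchrodinger T (Vpot M q ω)) (E : ℝ)
    (h : ∀ k f, 0 ≤ boxForm M (fun x => q (x - ω k) - (E + 2 * d)) f) (u : l2 d) :
    E * ‖u‖ ^ 2 ≤ inner ℝ (T u) u := by
  have h1 := (cellEquiv hM).hasSum_iff.2 (hT.hasSum_form E u)
  have h2 := h1.prod_fiberwise fun k => hasSum_fintype _
  have h3 := h2.nonneg fun k => ?_
  · linarith
  refine (h k fun x => u fun i => k i * M i + x i).trans ?_
  rw [boxForm, ← Finset.sum_coe_sort]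
  refine Finset.sum_le_sum fun x _ => ?_
  simp only [Function.comp_apply]
  rw [Vpot_cellEquiv hM hsupp hω]
  refine add_le_add (Finset.sum_le_sum fun i _ => ?_) le_rfl
  rcases (mem_dbox_one.1 x.2 i).2.lt_or_eq with hlt | heq
  · rw [cellEquiv_add_single_of_lt hM k x i hlt]; exact le_rfl
  · rw [bump_eq_self heq]
    simpa using sq_nonneg _

/-- Products of summable nonnegative functions of one integer variable are summable. -/
lemma summable_prod_int {d : ℕ} {g : ℤ → ℝ} (hg : ∀ t, 0 ≤ g t) (hs : Summable g) :
    Summable fun k : Zd d => ∏ i, g (k i) := by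
  refine summable_of_sum_le (c := ∏ _i : Fin d, ∑' t, g t)
    (fun k => Finset.prod_nonneg fun i _ => hg _) fun s => ?_
  have hsub : s ⊆ Fintype.piFinset fun i => s.image fun k => k i := by
    intro k hk
    rw [Fintype.mem_piFinset]
    exact fun i => Finset.mem_image_of_mem _ hk
  refine (Finset.sum_le_sum_of_subset_of_nonneg hsub
    fun k _ _ => Finset.prod_nonneg fun i _ => hg _).trans ?_
  rw [← Finset.prod_univ_sum (fun i => s.image fun k : Zd d => k i) fun _ t => g t]
  exact Finset.prod_le_prod (fun i _ => Finset.sum_nonneg fun t _ => hg t)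
    fun i _ => hs.sum_le_tsum _ fun t _ => hg t

/-- Slowly varying square-summable weights on the lattice. -/
lemma exists_slow_weight (d : ℕ) {δ : ℝ} (hδ : 0 < δ) :
    ∃ χ : Zd d → ℝ, Summable (fun k => χ k ^ 2) ∧ χ 0 ≠ 0 ∧
      ∀ k i, (χ (k + Pi.single i 1) - χ k) ^ 2 ≤ δ ^ 2 * χ k ^ 2 := by
  set ρ : ℝ := (1 + δ)⁻¹ with hρ
  have hρ0 : 0 < ρ := by positivity
  have hρ1 : ρ < 1 := inv_lt_one_of_one_lt₀ (by linarith)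
  have hρδ : ρ * (1 + δ) = 1 := inv_mul_cancel₀ (by positivity)
  have hstep : ∀ t : ℤ, (ρ ^ (t + 1).natAbs - ρ ^ t.natAbs) ^ 2
      ≤ δ ^ 2 * (ρ ^ t.natAbs) ^ 2 := by
    intro t
    rw [← mul_pow]
    refine sq_le_sq' ?_ ?_
    · rcases le_or_gt 0 t with ht | ht
      · rw [show (t + 1).natAbs = t.natAbs + 1 by omega, pow_succ]
        have : 0 < ρ ^ t.natAbs := by positivity
        nlinarith [mul_pos this hδ, mul_pos (mul_pos this hδ) hρ0]
      · rw [show t.natAbs = (t + 1).natAbs + 1 by omega, pow_succ]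
        have : 0 < ρ ^ (t + 1).natAbs := by positivity
        nlinarith [mul_pos this hδ, mul_pos (mul_pos this hδ) hρ0]
    · rcases le_or_gt 0 t with ht | ht
      · rw [show (t + 1).natAbs = t.natAbs + 1 by omega, pow_succ]
        have : 0 < ρ ^ t.natAbs := by positivity
        nlinarith [mul_pos this hδ, mul_pos (mul_pos this hδ) hρ0]
      · rw [show t.natAbs = (t + 1).natAbs + 1 by omega, pow_succ]
        have : 0 < ρ ^ (t + 1).natAbs := by positivity
        nlinarith [mul_pos this hδ, mul_pos (mul_pos this hδ) hρ0]
  refine ⟨fun k => ∏ i, ρ ^ (k i).natAbs, ?_, ?_, ?_⟩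
  · simp only [← Finset.prod_pow]
    refine summable_prod_int (g := fun t => (ρ ^ t.natAbs) ^ 2) (fun t => sq_nonneg _) ?_
    have hgeo : Summable fun n : ℕ => (ρ ^ n) ^ 2 := by
      simp only [← pow_mul, mul_comm _ 2]
      simp only [pow_mul]
      exact summable_geometric_of_lt_one (sq_nonneg _) (by nlinarith)
    exact Summable.of_nat_of_neg (by simpa using hgeo) (by simpa using hgeo)
  · simp
  · intro k i
    simp only
    rw [← Finset.mul_prod_erase _ _ (Finset.mem_univ i),
      ← Finset.mul_prod_erase Finset.univ (fun j => ρ ^ (k j).natAbs) (Finset.mem_univ i)]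
    have : ∏ j ∈ Finset.univ.erase i, ρ ^ ((k + Pi.single i 1 : Zd d) j).natAbs
        = ∏ j ∈ Finset.univ.erase i, ρ ^ (k j).natAbs := by
      refine Finset.prod_congr rfl fun j hj => ?_
      simp [Finset.ne_of_mem_erase hj]
    rw [this, ← sub_mul, mul_pow, mul_pow, ← mul_assoc]
    refine mul_le_mul_of_nonneg_right ?_ (sq_nonneg _)
    simpa using hstep (k i)

/-- The coordinates in which the cell with index `k` is reflected by `ω*`. -/
def oddSet {d : ℕ} (k : Zd d) : Finset (Fin d) := Finset.univ.filter fun i => ¬ Even (k i)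

lemma reflectSet_oddSet_update {d : ℕ} {M : Zd d} (k x : Zd d) (i : Fin d) (h : x i = M i) :
    reflectSet M (oddSet (k + Pi.single i 1)) (Function.update x i 1)
      = reflectSet M (oddSet k) x := by
  funext j
  by_cases hj : j = i
  · subst hj
    by_cases hk : Even (k j) <;> simp [reflectSet, oddSet, hk, h]
  · simp [reflectSet, oddSet, hj]

lemma apply_sub_ωstar {d : ℕ} {M b : Zd d} {q : Zd d → ℝ}
    (hH1 : ∀ (x : Zd d) (i : Fin d), q x = q (Function.update x i (b i - x i + 1)))
    (k x : Zd d) : q (x - ωstar M b k) = q (reflectSet M (oddSet k) x) := by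
  rw [← reflectSet_invariant hH1 (oddSet k) (x - ωstar M b k)]
  congr 1
  funext i
  by_cases hk : Even (k i)
  · have hmem : i ∉ oddSet k := by simp [oddSet, hk]
    simp [reflectSet, hmem, hk, ωstar]
  · have hmem : i ∈ oddSet k := by simpa [oddSet] using hk
    simp only [reflectSet, hmem, if_true, ωstar, Pi.sub_apply, hk, if_false]
    ring

lemma reflectSet_mem {d : ℕ} {M : Zd d} (s : Finset (Fin d)) {x : Zd d}
    (hx : x ∈ dbox (fun _ => 1) M) : reflectSet M s x ∈ dbox (fun _ => 1) M := by
  rw [mem_dbox_one] at hx ⊢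
  intro i
  have := hx i
  unfold reflectSet; split_ifs <;> omega

/-- A trial function prescribed on the cells of the lattice. -/
lemma exists_l2_of_cells {d : ℕ} {M : Zd d} (hM : ∀ i, 1 ≤ M i)
    {w : Zd d × {x // x ∈ dbox (fun _ => 1) M} → ℝ} (hw : Summable fun p => w p ^ 2) :
    ∃ u : l2 d, ∀ p, u (cellEquiv hM p) = w p := by
  have hmem : Memℓp (fun n => w ((cellEquiv hM).symm n)) 2 := by
    refine memℓp_gen ?_
    have := ((cellEquiv hM).symm.summable_iff (f := fun p => w p ^ 2)).2 hw
    simpa [Function.comp_def] using this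
  refine ⟨⟨_, hmem⟩, fun p => ?_⟩
  exact congrArg w ((cellEquiv hM).symm_apply_apply p)

/-- The function equal to `χ k` times a reflected copy of `f` on the cell with index `k`. -/
lemma exists_l2_reflected {d : ℕ} {M : Zd d} (hM : ∀ i, 1 ≤ M i) {χ : Zd d → ℝ}
    (hχ : Summable fun k => χ k ^ 2) (f : Zd d → ℝ) :
    ∃ u : l2 d, ∀ k (x : {x // x ∈ dbox (fun _ => 1) M}),
      u (cellEquiv hM (k, x)) = χ k * f (reflectSet M (oddSet k) x.1) := by
  set C := ∑ x ∈ dbox (fun _ => 1) M, f x ^ 2 with hC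
  have hC0 : 0 ≤ C := Finset.sum_nonneg fun _ _ => sq_nonneg _
  have hsum : Summable fun p : Zd d × {x // x ∈ dbox (fun _ => 1) M} => χ p.1 ^ 2 * C :=
    (summable_prod_of_nonneg fun p => mul_nonneg (sq_nonneg _) hC0).2
      ⟨fun k => (hasSum_fintype _).summable, by
        simpa [tsum_fintype] using (hχ.mul_right C).mul_left _⟩
  have hw : Summable fun p : Zd d × {x // x ∈ dbox (fun _ => 1) M} =>
      (χ p.1 * f (reflectSet M (oddSet p.1) p.2.1)) ^ 2 := by
    refine Summable.of_nonneg_of_le (fun _ => sq_nonneg _) (fun p => ?_) hsum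
    rw [mul_pow]
    refine mul_le_mul_of_nonneg_left ?_ (sq_nonneg _)
    exact Finset.single_le_sum (f := fun x => f x ^ 2) (fun _ _ => sq_nonneg _)
      (reflectSet_mem (oddSet p.1) p.2.2)
  obtain ⟨u, hu⟩ := exists_l2_of_cells hM hw
  exact ⟨u, fun k x => hu (k, x)⟩

lemma bond_reflected_le {d : ℕ} {M : Zd d} (hM : ∀ i, 1 ≤ M i) {χ f u : Zd d → ℝ} {δ : ℝ}
    (hχ : ∀ k i, (χ (k + Pi.single i 1) - χ k) ^ 2 ≤ δ ^ 2 * χ k ^ 2)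
    (hu : ∀ k (x : {x // x ∈ dbox (fun _ => 1) M}),
      u (cellEquiv hM (k, x)) = χ k * f (reflectSet M (oddSet k) x.1))
    (k : Zd d) (x : {x // x ∈ dbox (fun _ => 1) M}) (i : Fin d) :
    (u (cellEquiv hM (k, x) + Pi.single i 1) - u (cellEquiv hM (k, x))) ^ 2
      ≤ χ k ^ 2 * ((f (reflectSet M (oddSet k) (bump M i x.1))
          - f (reflectSet M (oddSet k) x.1)) ^ 2
        + δ ^ 2 * f (reflectSet M (oddSet k) x.1) ^ 2) := by
  rcases (mem_dbox_one.1 x.2 i).2.lt_or_eq with hlt | heq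
  · rw [cellEquiv_add_single_of_lt hM k x i hlt, hu, hu, ← mul_sub, mul_pow]
    refine mul_le_mul_of_nonneg_left ?_ (sq_nonneg _)
    exact le_add_of_nonneg_right (by positivity)
  · obtain ⟨hmem, he⟩ := cellEquiv_add_single_of_eq hM k x i heq
    rw [he, hu, hu, bump_eq_self heq, reflectSet_oddSet_update k x.1 i heq, ← sub_mul, mul_pow,
      sub_self]
    refine (mul_le_mul_of_nonneg_right (hχ k i) (sq_nonneg _)).trans (le_of_eq ?_)
    ring

lemma cell_reflected_le {d : ℕ} {M b : Zd d} (hM : ∀ i, 1 ≤ M i)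
    {q : Zd d → ℝ} (hsupp : ∀ n, n ∉ dbox (fun _ => 1) b → q n = 0)
    (hH1 : ∀ (x : Zd d) (i : Fin d), q x = q (Function.update x i (b i - x i + 1)))
    (hadm : adm M b (ωstar M b)) {χ f u : Zd d → ℝ} {δ : ℝ}
    (hχ : ∀ k i, (χ (k + Pi.single i 1) - χ k) ^ 2 ≤ δ ^ 2 * χ k ^ 2)
    (hu : ∀ k (x : {x // x ∈ dbox (fun _ => 1) M}),
      u (cellEquiv hM (k, x)) = χ k * f (reflectSet M (oddSet k) x.1)) (E : ℝ) (k : Zd d) :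
    ∑ x : {x // x ∈ dbox (fun _ => 1) M},
      (∑ i, (u (cellEquiv hM (k, x) + Pi.single i 1) - u (cellEquiv hM (k, x))) ^ 2
        + (Vpot M q (ωstar M b) (cellEquiv hM (k, x)) - E) * u (cellEquiv hM (k, x)) ^ 2)
      ≤ χ k ^ 2 * boxForm M (fun x => q x - E + d * δ ^ 2) f := by
  rw [← boxForm_reflectSet hM (oddSet k), boxForm, ← Finset.sum_coe_sort (dbox (fun _ => 1) M), Finset.mul_sum]
  refine Finset.sum_le_sum fun x _ => ?_
  have hbond := Finset.sum_le_sum fun i (_ : i ∈ Finset.univ) => bond_reflected_le hM hχ hu k x i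
  refine (add_le_add_left hbond _).trans (le_of_eq ?_)
  rw [Vpot_cellEquiv hM hsupp hadm, apply_sub_ωstar hH1, hu, ← Finset.mul_sum,
    Finset.sum_add_distrib, Finset.sum_const, Finset.card_univ, Fintype.card_fin, nsmul_eq_mul]
  ring

/-- A lower bound for the form of `h_{ω*}` bounds the Neumann form at the corner from below. -/
lemma IsSchrodinger.boxForm_nonneg {d : ℕ} {M b : Zd d} (hM : ∀ i, 1 ≤ M i)
    (hbM : ∀ i, b i ≤ M i) {q : Zd d → ℝ}
    (hsupp : ∀ n, n ∉ dbox (fun _ => 1) b → q n = 0)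
    (hH1 : ∀ (x : Zd d) (i : Fin d), q x = q (Function.update x i (b i - x i + 1)))
    {T : l2 d →L[ℝ] l2 d} (hT : IsSchrodinger T (Vpot M q (ωstar M b))) (E : ℝ)
    (h : ∀ u, E * ‖u‖ ^ 2 ≤ inner ℝ (T u) u) (f : Zd d → ℝ) :
    0 ≤ boxForm M (fun x => q x - (E + 2 * d)) f := by
  have hadm : adm M b (ωstar M b) := by
    intro k i
    have := hbM i
    unfold ωstar; split_ifs <;> omega
  set C := ∑ x ∈ dbox (fun _ => 1) M, f x ^ 2 with hC
  have key : ∀ δ : ℝ, 0 < δ →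
      0 ≤ boxForm M (fun x => q x - (E + 2 * d) + d * δ ^ 2) f := by
    intro δ hδ
    obtain ⟨χ, hχs, hχ0, hχ⟩ := exists_slow_weight d hδ
    obtain ⟨u, hu⟩ := exists_l2_reflected hM hχs f
    have h1 := (cellEquiv hM).hasSum_iff.2 (hT.hasSum_form E u)
    have h2 := h1.prod_fiberwise fun k => hasSum_fintype _
    have h3 := hasSum_le (α := ℝ)
      (fun k : Zd d => cell_reflected_le hM hsupp hH1 hadm hχ hu (E + 2 * d) k) h2
      (hχs.hasSum.mul_right _)
    have hpos : 0 < ∑' k, χ k ^ 2 := hχs.tsum_pos (fun _ => sq_nonneg _) 0 (by positivity)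
    exact nonneg_of_mul_nonneg_right ((sub_nonneg.2 (h u)).trans h3) hpos
  have hexp : ∀ δ : ℝ, boxForm M (fun x => q x - (E + 2 * d) + d * δ ^ 2) f
      = boxForm M (fun x => q x - (E + 2 * d)) f + d * δ ^ 2 * C := by
    intro δ
    rw [boxForm, boxForm, hC, Finset.mul_sum, ← Finset.sum_add_distrib]
    exact Finset.sum_congr rfl fun x _ => by ring
  have hlim : Filter.Tendsto
      (fun δ : ℝ => boxForm M (fun x => q x - (E + 2 * d)) f + d * δ ^ 2 * C)
      (nhdsWithin 0 (Set.Ioi 0)) (nhds (boxForm M (fun x => q x - (E + 2 * d)) f)) := by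
    have hc : Continuous
        (fun δ : ℝ => boxForm M (fun x => q x - (E + 2 * d)) f + d * δ ^ 2 * C) := by fun_prop
    have := hc.tendsto 0
    simp only [ne_eq, OfNat.ofNat_ne_zero, not_false_eq_true, zero_pow, mul_zero, zero_mul,
      add_zero] at this
    exact this.mono_left nhdsWithin_le_nhds
  refine ge_of_tendsto hlim ?_
  filter_upwards [self_mem_nhdsWithin] with δ hδ
  rw [← hexp]
  exact key δ hδ

end Lattice

/-- `ω*` is spectrally minimizing:  assume (H1) and either (i) `d ≥ 2` and `q ≠ 0` is
sign-definite, or (ii) `d = 1` and `E_0(a) ≠ -2` for at least one `a ∈ Δ`.  Then for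
every admissible configuration `ω`, `min σ(h_{ω*}) ≤ min σ(h_ω)`. -/
theorem omega_star_spectrally_minimizing
    (d : ℕ) (hd : 1 ≤ d) (M b : Zd d)
    (hb : ∀ i, 1 ≤ b i) (hbM : ∀ i, b i ≤ M i)
    (q : Zd d → ℝ)
    (hsupp : ∀ n, n ∉ dbox (fun _ => 1) b → q n = 0)
    (hH1 : ∀ (x : Zd d) (i : Fin d), q x = q (Function.update x i (b i - x i + 1)))
    (hcase : (2 ≤ d ∧ q ≠ 0 ∧ ((∀ n, 0 ≤ q n) ∨ (∀ n, q n ≤ 0)))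
      ∨ (d = 1 ∧ ∃ a : Zd d, (∀ i, 0 ≤ a i ∧ a i ≤ M i - b i) ∧ E0 M q a ≠ -2))
    (H : (Zd d → Zd d) → (l2 d →L[ℝ] l2 d))
    (hH : ∀ ω, adm M b ω → ∀ (u : l2 d) (n : Zd d),
      (H ω u) n = (-∑ j ∈ nbhd n, u j) + Vpot M q ω n * u n) :
    ∀ ω, adm M b ω →
      sInf (spectrum ℝ (H (ωstar M b))) ≤ sInf (spectrum ℝ (H ω)) := by
  intro ω hω
  have hM : ∀ i, 1 ≤ M i := fun i => (hb i).trans (hbM i)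
  have hstar : adm M b (ωstar M b) := by
    intro k i
    have := hbM i
    unfold ωstar; split_ifs <;> omega
  have hT : IsSchrodinger (H ω) (Vpot M q ω) := hH ω hω
  have hTs : IsSchrodinger (H (ωstar M b)) (Vpot M q (ωstar M b)) := hH _ hstar
  have : Nontrivial (l2 d) := by
    refine ⟨lp.single 2 0 1, 0, fun h => ?_⟩
    have := congrArg (fun v : l2 d => v 0) h
    simp at this
  obtain ⟨m, hm, hmin⟩ := exists_isLeast_spectrum hTs.symmetric
  obtain ⟨m', -, hmin'⟩ := exists_isLeast_spectrum hT.symmetric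
  rw [hmin.csInf_eq, hmin'.csInf_eq]
  refine le_of_mem_spectrum (hT.form_lower_bound hM hsupp hω m fun k => ?_) hmin'.1
  exact boxForm_nonneg_of_corner hb hbM hsupp hH1 _
    (hTs.boxForm_nonneg hM hbM hsupp hH1 m hm) (ω k) (hω k)
end
end
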